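/- arXiv:1309.1146 — 2 statements merged into one kernel-verified Lean document; each statement's English description precedes it below -/
import Mathlib

section
/- Law of large numbers for the Hadamard quantum random walk started from the origin with uniformly mixed coin: for every bounded continuous function g : ℝ → ℝ, lim_{n→∞} Σ_{j∈ℤ} pₙ(0, j) g(j/n) = ∫_ℝ g(y) f(y) dy. That is, the rescaled position distribution (pₙ(0, ⌊n·⌋)) converges weakly to the probability measure on ℝ with density f. -/
open Filter
open scoped ENNReal Topology

noncomputable section

/-- The state space `ℓ²(ℤ; ℂ²)` of the Hadamard quantum walk. -/
abbrev QWState : Type := lp (fun _ : ℤ => EuclideanSpace ℂ (Fin 2)) 2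

/-- The walk started at site `k` with pure coin state `c`
(`c = 0` is the coin `+`, `c = 1` is the coin `−`): the unit vector `δ_k ⊗ c`. -/
def deltaCoin (k : ℤ) (c : Fin 2) : QWState := lp.single 2 k (EuclideanSpace.single c 1)

/-- The Konno density: `f(x) = 1/(π(1−x²)√(1−2x²))` for `|x| < 1/√2`, and `0` otherwise. -/
def konno (x : ℝ) : ℝ :=
  if |x| < 1 / Real.sqrt 2 then 1 / (Real.pi * (1 - x ^ 2) * Real.sqrt (1 - 2 * x ^ 2)) else 0

open MeasureTheory AddCircle ComplexConjugate

instance two_pi_pos_fact : Fact (0 < 2 * Real.pi) := ⟨Real.two_pi_pos⟩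

/-- The Fourier symbol of the Hadamard walk, as a matrix of trigonometric polynomials. -/
def walkSymbol : Matrix (Fin 2) (Fin 2) C(AddCircle (2 * Real.pi), ℂ) :=
  !![(Real.sqrt 2 : ℂ)⁻¹ • fourier 1, (Real.sqrt 2 : ℂ)⁻¹ • fourier 1;
    (Real.sqrt 2 : ℂ)⁻¹ • fourier (-1), -((Real.sqrt 2 : ℂ)⁻¹ • fourier (-1))]

lemma integrable_continuousMap {T : ℝ} [Fact (0 < T)] (f : C(AddCircle T, ℂ)) :
    Integrable f haarAddCircle :=
  f.continuous.integrable_of_hasCompactSupport (HasCompactSupport.of_compactSpace _)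

lemma fourierCoeff_fourier_mul {T : ℝ} [Fact (0 < T)] (m : ℤ) (f : C(AddCircle T, ℂ)) (j : ℤ) :
    fourierCoeff (fourier m * f : C(AddCircle T, ℂ)) j = fourierCoeff f (j - m) := by
  simp only [fourierCoeff, ContinuousMap.mul_apply, smul_eq_mul, ← mul_assoc]
  simp_rw [← fourier_add, neg_sub', sub_neg_eq_add]

lemma fourierCoeff_walkSymbol_step {T : ℝ} [Fact (0 < T)] (m : ℤ) (s : ℂ)
    (f g : C(AddCircle T, ℂ)) (j : ℤ) :
    fourierCoeff (s • fourier m * (f + g) : C(AddCircle T, ℂ)) j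
      = s * (fourierCoeff f (j - m) + fourierCoeff g (j - m)) := by
  have h : (⇑(s • fourier m * (f + g) : C(AddCircle T, ℂ)))
      = s • ⇑(fourier m * (f + g) : C(AddCircle T, ℂ)) := by
    ext x; simp
  rw [h, fourierCoeff.const_smul, fourierCoeff_fourier_mul, ContinuousMap.coe_add,
    fourierCoeff.add (integrable_continuousMap f) (integrable_continuousMap g), smul_eq_mul]
  rfl

lemma fourierCoeff_neg_continuousMap {T : ℝ} [Fact (0 < T)] (f : C(AddCircle T, ℂ)) (j : ℤ) :
    fourierCoeff (-f : C(AddCircle T, ℂ)) j = -fourierCoeff f j := by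
  simp [fourierCoeff, integral_neg]

theorem amplitude_eq_fourierCoeff (U : QWState →ₗ[ℂ] QWState)
    (hU : ∀ (ψ : QWState) (k : ℤ),
      (U ψ) k 0 = (ψ (k - 1) 0 + ψ (k - 1) 1) / (Real.sqrt 2 : ℂ) ∧
      (U ψ) k 1 = (ψ (k + 1) 0 - ψ (k + 1) 1) / (Real.sqrt 2 : ℂ))
    (n : ℕ) (c d : Fin 2) (j : ℤ) :
    ((U ^ n) (deltaCoin 0 c)) j d = fourierCoeff ((walkSymbol ^ n) d c) j := by
  induction n generalizing d j with
  | zero =>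
    have h1 : fourierCoeff (1 : AddCircle (2 * Real.pi) → ℂ) = Pi.single 0 1 := by
      rw [← fourierCoeff_fourier (T := 2 * Real.pi)]
      congr 1
      ext x; simp
    have h0 (j : ℤ) : fourierCoeff (0 : AddCircle (2 * Real.pi) → ℂ) j = 0 := by
      simp [fourierCoeff]
    simp only [pow_zero, deltaCoin, Module.End.one_apply, lp.coeFn_single, Matrix.one_apply]
    by_cases hj : j = 0
    · subst hj
      by_cases hd : d = c
      · subst hd; simp [h1]
      · simp [hd, h0]
    · by_cases hd : d = c
      · subst hd; simp [h1, hj]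
      · simp [hd, h0, hj]
  | succ n ih =>
    rw [pow_succ', pow_succ', Module.End.mul_apply, Matrix.mul_apply, Fin.sum_univ_two]
    obtain ⟨h0, h1⟩ := hU ((U ^ n) (deltaCoin 0 c)) j
    fin_cases d
    · simp only [Fin.zero_eta, h0, ih]
      simp only [walkSymbol, Matrix.of_apply, Matrix.cons_val_zero, Matrix.cons_val_one,
        Matrix.cons_val', Matrix.cons_val_fin_one]
      rw [← mul_add, fourierCoeff_walkSymbol_step]
      ring
    · simp only [Fin.mk_one, h1, ih]
      simp only [walkSymbol, Matrix.of_apply, Matrix.cons_val_zero, Matrix.cons_val_one,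
        Matrix.cons_val', Matrix.cons_val_fin_one]
      rw [neg_mul, ← mul_neg, ← mul_add, fourierCoeff_walkSymbol_step,
        fourierCoeff_neg_continuousMap, sub_neg_eq_add]
      ring

/-- Parseval's identity, twisted by a translation of the circle. -/
theorem hasSum_sq_fourierCoeff_mul_exp (f : C(AddCircle (2 * Real.pi), ℂ)) (ε : ℝ) :
    HasSum (fun j : ℤ => ((‖fourierCoeff f j‖ ^ 2 : ℝ) : ℂ) * Complex.exp (ε * j * Complex.I))
      (∫ x, conj (f x) * f (x + (ε : AddCircle (2 * Real.pi))) ∂haarAddCircle) := by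
  let g : C(AddCircle (2 * Real.pi), ℂ) :=
    ⟨fun x => f (x + (ε : AddCircle (2 * Real.pi))), by fun_prop⟩
  have hg : ∀ j, fourierCoeff g j = fourierCoeff f j * Complex.exp (ε * j * Complex.I) := by
    intro j
    have h := integral_add_right_eq_self (μ := haarAddCircle)
      (fun x : AddCircle (2 * Real.pi) =>
        fourier (-j) (x - (ε : AddCircle (2 * Real.pi))) • f x)
      (ε : AddCircle (2 * Real.pi))
    simp only [add_sub_cancel_right] at h
    simp only [fourierCoeff, g, ContinuousMap.coe_mk]
    rw [h, ← integral_mul_const]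
    refine integral_congr_ae (.of_forall fun x => ?_)
    have h2 : fourier (-j) (-(ε : AddCircle (2 * Real.pi))) = Complex.exp (ε * j * Complex.I) := by
      rw [← QuotientAddGroup.mk_neg, fourier_coe_apply]
      congr 1
      have : (Real.pi : ℂ) ≠ 0 := by exact_mod_cast Real.pi_ne_zero
      push_cast
      field_simp
    have h3 : fourier (-j) (x - (ε : AddCircle (2 * Real.pi)))
        = fourier (-j) x * Complex.exp (ε * j * Complex.I) := by
      rw [← h2]
      simp only [fourier_apply, sub_eq_add_neg, smul_add, toCircle_add, Circle.coe_mul]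
    simp only [h3, smul_eq_mul]
    ring
  have h := fourierBasis.hasSum_inner_mul_inner
    (ContinuousMap.toLp 2 haarAddCircle ℂ f) (ContinuousMap.toLp 2 haarAddCircle ℂ g)
  rw [ContinuousMap.inner_toLp] at h
  have hsum : ∀ j : ℤ, ((‖fourierCoeff f j‖ ^ 2 : ℝ) : ℂ) * Complex.exp (ε * j * Complex.I) =
      inner ℂ (ContinuousMap.toLp 2 haarAddCircle ℂ f) (fourierBasis j) *
        inner ℂ (fourierBasis j) (ContinuousMap.toLp 2 haarAddCircle ℂ g) := by
    intro j
    rw [← inner_conj_symm, ← HilbertBasis.repr_apply_apply, ← HilbertBasis.repr_apply_apply,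
      fourierBasis_repr, fourierBasis_repr, fourierCoeff_toLp, fourierCoeff_toLp, hg, ← mul_assoc,
      Complex.conj_mul']
    push_cast
    rfl
  have hint : ∀ x, conj (f x) * f (x + (ε : AddCircle (2 * Real.pi))) = g x * conj (f x) :=
    fun x => mul_comm _ _
  simp_rw [hsum, hint]
  exact h

/-- The positive square root of `1 + cos² θ`. -/
def walkSpeedDenom (θ : ℝ) : ℝ := Real.sqrt (1 + Real.cos θ ^ 2)

/-- The phase `ω(θ)` of the eigenvalues `exp(iω)`, `-exp(-iω)` of the symbol. -/
def walkPhase (θ : ℝ) : ℝ := Real.arcsin (Real.sin θ / Real.sqrt 2)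

/-- The group velocity, i.e. the derivative of the phase. -/
def walkVelocity (θ : ℝ) : ℝ := Real.cos θ / walkSpeedDenom θ

/-- The traceless Hermitian involution commuting with the symbol at `θ`. -/
def walkInvolution (θ : ℝ) : Matrix (Fin 2) (Fin 2) ℂ :=
  (walkSpeedDenom θ : ℂ)⁻¹ •
    !![(Real.cos θ : ℂ), Real.cos θ + Real.sin θ * Complex.I;
      Real.cos θ - Real.sin θ * Complex.I, -(Real.cos θ : ℂ)]

/-- The normalized Hilbert–Schmidt overlap of the involutions at `θ` and `η`. -/
def walkOverlap (θ η : ℝ) : ℝ :=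
  (Real.cos θ * Real.cos η + Real.cos (θ - η)) / (walkSpeedDenom θ * walkSpeedDenom η)

/-- The Hilbert–Schmidt inner product of the `n`-th powers of the symbol at `θ` and `η`. -/
def walkCorrelation (n : ℕ) (θ η : ℝ) : ℂ :=
  (1 + walkOverlap θ η) / 2 *
      (Complex.exp ((walkPhase η - walkPhase θ) * Complex.I) ^ n
        + Complex.exp (-(walkPhase η - walkPhase θ) * Complex.I) ^ n)
    + (1 - walkOverlap θ η) / 2 *
      ((-Complex.exp (-(walkPhase η + walkPhase θ) * Complex.I)) ^ n
        + (-Complex.exp ((walkPhase η + walkPhase θ) * Complex.I)) ^ n)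

lemma walkSpeedDenom_pos (θ : ℝ) : 0 < walkSpeedDenom θ := by
  unfold walkSpeedDenom; positivity

lemma walkSpeedDenom_sq (θ : ℝ) : walkSpeedDenom θ ^ 2 = 1 + Real.cos θ ^ 2 :=
  Real.sq_sqrt (by positivity)

lemma one_le_walkSpeedDenom (θ : ℝ) : 1 ≤ walkSpeedDenom θ := by
  nlinarith [walkSpeedDenom_sq θ, walkSpeedDenom_pos θ, sq_nonneg (Real.cos θ)]

@[fun_prop]
lemma continuous_walkSpeedDenom : Continuous walkSpeedDenom := by
  unfold walkSpeedDenom; fun_prop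

@[fun_prop]
lemma continuous_walkPhase : Continuous walkPhase := by
  unfold walkPhase; fun_prop

@[fun_prop]
lemma continuous_walkVelocity : Continuous walkVelocity :=
  Real.continuous_cos.div continuous_walkSpeedDenom fun θ => (walkSpeedDenom_pos θ).ne'

lemma abs_sin_div_sqrt_two_lt_one (θ : ℝ) : |Real.sin θ / Real.sqrt 2| < 1 := by
  have h2 : (1 : ℝ) < Real.sqrt 2 := Real.lt_sqrt_of_sq_lt (by norm_num)
  rw [abs_div, abs_of_pos (by linarith : (0 : ℝ) < Real.sqrt 2), div_lt_one (by linarith)]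
  exact (Real.abs_sin_le_one θ).trans_lt h2

lemma sin_walkPhase (θ : ℝ) : Real.sin (walkPhase θ) = Real.sin θ / Real.sqrt 2 := by
  have h := abs_lt.1 (abs_sin_div_sqrt_two_lt_one θ)
  exact Real.sin_arcsin h.1.le h.2.le

lemma one_sub_sq_sin_div_sqrt_two (θ : ℝ) :
    1 - (Real.sin θ / Real.sqrt 2) ^ 2 = (1 + Real.cos θ ^ 2) / 2 := by
  rw [div_pow, Real.sq_sqrt (by norm_num), Real.sin_sq]; ring

lemma cos_walkPhase (θ : ℝ) : Real.cos (walkPhase θ) = walkSpeedDenom θ / Real.sqrt 2 := by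
  rw [walkPhase, Real.cos_arcsin, one_sub_sq_sin_div_sqrt_two, Real.sqrt_div (by positivity),
    walkSpeedDenom]

lemma hasDerivAt_walkPhase (θ : ℝ) : HasDerivAt walkPhase (walkVelocity θ) θ := by
  have h := abs_lt.1 (abs_sin_div_sqrt_two_lt_one θ)
  have := (Real.hasDerivAt_arcsin h.1.ne' h.2.ne).comp θ ((Real.hasDerivAt_sin θ).div_const _)
  refine this.congr_deriv ?_
  rw [one_sub_sq_sin_div_sqrt_two, Real.sqrt_div (by positivity), walkVelocity, walkSpeedDenom]
  have : 0 < Real.sqrt (1 + Real.cos θ ^ 2) := by positivity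
  field_simp

lemma walkInvolution_mul_self (θ : ℝ) : walkInvolution θ * walkInvolution θ = 1 := by
  have h0 : (walkSpeedDenom θ : ℂ) ≠ 0 := by exact_mod_cast (walkSpeedDenom_pos θ).ne'
  have h1 : (walkSpeedDenom θ : ℂ) ^ 2 = 1 + Real.cos θ ^ 2 := by
    exact_mod_cast walkSpeedDenom_sq θ
  have h2 : (Real.sin θ : ℂ) ^ 2 + Real.cos θ ^ 2 = 1 := by
    exact_mod_cast Real.sin_sq_add_cos_sq θ
  rw [walkInvolution, Matrix.smul_mul, Matrix.mul_smul, smul_smul, ← mul_inv, ← sq, h1,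
    Matrix.mul_fin_two]
  rw [h1.symm ▸ pow_ne_zero 2 h0 |> inv_smul_eq_iff₀, Matrix.one_fin_two]
  ext i j
  fin_cases i <;> fin_cases j <;> simp [-Complex.ofReal_cos, -Complex.ofReal_sin] <;>
    first
    | ring1
    | linear_combination h2 - (Real.sin θ : ℂ) ^ 2 * Complex.I_sq

lemma continuousMap_matrix_pow_apply {X ι : Type*} [TopologicalSpace X] [Fintype ι] [DecidableEq ι]
    (A : Matrix ι ι C(X, ℂ)) (n : ℕ) (i j : ι) (x : X) :
    (A ^ n) i j x = ((A.map fun f => f x) ^ n) i j := by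
  induction n generalizing i j with
  | zero => by_cases h : i = j <;> simp [h]
  | succ n ih => simp [pow_succ, Matrix.mul_apply, ih]

lemma walkSymbol_map_coe (θ : ℝ) :
    (walkSymbol.map fun f => f (θ : AddCircle (2 * Real.pi)))
      = (Real.cos (walkPhase θ) : ℂ) • walkInvolution θ
        + (Real.sin (walkPhase θ) * Complex.I) • 1 := by
  have h0 : (walkSpeedDenom θ : ℂ) ≠ 0 := by exact_mod_cast (walkSpeedDenom_pos θ).ne'
  have h1 : (Real.sqrt 2 : ℂ) ≠ 0 := by simp
  have hpi : (Real.pi : ℂ) ≠ 0 := by exact_mod_cast Real.pi_ne_zero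
  have e1 : fourier 1 (θ : AddCircle (2 * Real.pi)) = Real.cos θ + Real.sin θ * Complex.I := by
    rw [fourier_coe_apply, Complex.ofReal_cos, Complex.ofReal_sin, ← Complex.exp_mul_I]
    congr 1; push_cast; field_simp
  have e2 : fourier (-1) (θ : AddCircle (2 * Real.pi)) = Real.cos θ - Real.sin θ * Complex.I := by
    rw [fourier_neg, e1]; simp [-Complex.ofReal_cos, -Complex.ofReal_sin, sub_eq_add_neg]
  rw [cos_walkPhase, sin_walkPhase, walkInvolution]
  ext i j
  fin_cases i <;> fin_cases j <;>
    simp [walkSymbol, e1, e2, -Complex.ofReal_cos, -Complex.ofReal_sin] <;> (field_simp; try ring1)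

lemma pow_smul_involution_add_smul_one {A N : Matrix (Fin 2) (Fin 2) ℂ} {a b : ℂ}
    (hN : N * N = 1) (hA : A = a • N + b • 1) (n : ℕ) :
    A ^ n = (((b + a) ^ n + (b - a) ^ n) / 2) • 1 + (((b + a) ^ n - (b - a) ^ n) / 2) • N := by
  induction n with
  | zero => simp
  | succ n ih =>
    rw [pow_succ, ih, hA]
    simp only [add_mul, mul_add, Matrix.smul_mul, Matrix.mul_smul, hN, one_mul, mul_one]
    module

lemma sum_conj_mul_involution (u v u' v' : ℂ) (θ η : ℝ) :
    ∑ c, ∑ d, conj ((((u + v) / 2) • (1 : Matrix (Fin 2) (Fin 2) ℂ)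
        + ((u - v) / 2) • walkInvolution θ) d c) *
      (((u' + v') / 2) • (1 : Matrix (Fin 2) (Fin 2) ℂ)
        + ((u' - v') / 2) • walkInvolution η) d c
    = (1 + walkOverlap θ η) / 2 * (conj u * u' + conj v * v')
      + (1 - walkOverlap θ η) / 2 * (conj u * v' + conj v * u') := by
  have h0 : (walkSpeedDenom θ : ℂ) ≠ 0 := by exact_mod_cast (walkSpeedDenom_pos θ).ne'
  have h1 : (walkSpeedDenom η : ℂ) ≠ 0 := by exact_mod_cast (walkSpeedDenom_pos η).ne'
  have h2 : conj (2 : ℂ) = 2 := map_ofNat _ 2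
  simp [Fin.sum_univ_two, walkInvolution, walkOverlap, Real.cos_sub, h2,
    -Complex.ofReal_cos, -Complex.ofReal_sin]
  field_simp
  ring_nf
  simp only [Complex.I_sq]
  ring

theorem sum_conj_walkSymbol_pow (n : ℕ) (θ η : ℝ) :
    ∑ c, ∑ d, conj ((walkSymbol ^ n) d c (θ : AddCircle (2 * Real.pi))) *
      (walkSymbol ^ n) d c (η : AddCircle (2 * Real.pi)) = walkCorrelation n θ η := by
  have hu (θ : ℝ) : (Real.sin (walkPhase θ) * Complex.I + Real.cos (walkPhase θ) : ℂ)
      = Complex.exp (walkPhase θ * Complex.I) := by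
    rw [Complex.exp_mul_I]; push_cast; ring
  have hv (θ : ℝ) : (Real.sin (walkPhase θ) * Complex.I - Real.cos (walkPhase θ) : ℂ)
      = -Complex.exp (-walkPhase θ * Complex.I) := by
    rw [Complex.exp_mul_I, Complex.cos_neg, Complex.sin_neg]; push_cast; ring
  simp_rw [continuousMap_matrix_pow_apply, pow_smul_involution_add_smul_one
    (walkInvolution_mul_self _) (walkSymbol_map_coe _), sum_conj_mul_involution, hu, hv,
    walkCorrelation, map_pow, ← mul_pow, map_neg, ← Complex.exp_conj, neg_mul_neg, neg_mul,
    mul_neg, ← Complex.exp_add]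
  simp only [map_neg, map_mul, Complex.conj_ofReal, Complex.conj_I]
  ring_nf

lemma walkOverlap_self (θ : ℝ) : walkOverlap θ θ = 1 := by
  have := walkSpeedDenom_sq θ
  have h0 := (walkSpeedDenom_pos θ).ne'
  rw [walkOverlap, sub_self, Real.cos_zero, ← sq, ← sq, this, add_comm, div_self]
  positivity

lemma walkCorrelation_self (n : ℕ) (θ : ℝ) : walkCorrelation n θ θ = 2 := by
  simp [walkCorrelation, walkOverlap_self]
  norm_num

lemma abs_walkOverlap_le (θ η : ℝ) : |walkOverlap θ η| ≤ 2 := by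
  have h1 := one_le_walkSpeedDenom θ
  have h2 := one_le_walkSpeedDenom η
  have h3 : 1 ≤ walkSpeedDenom θ * walkSpeedDenom η := one_le_mul_of_one_le_of_one_le h1 h2
  rw [walkOverlap, abs_div, abs_of_pos (by linarith : 0 < walkSpeedDenom θ * walkSpeedDenom η),
    div_le_iff₀ (by linarith)]
  have h4 : |Real.cos θ * Real.cos η| ≤ 1 := by
    rw [abs_mul]
    exact mul_le_one₀ (Real.abs_cos_le_one _) (abs_nonneg _) (Real.abs_cos_le_one _)
  have h5 := Real.abs_cos_le_one (θ - η)
  have h6 := abs_add_le (Real.cos θ * Real.cos η) (Real.cos (θ - η))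
  linarith

@[fun_prop]
lemma continuous_walkOverlap (θ : ℝ) : Continuous (walkOverlap θ) :=
  Continuous.div (by fun_prop) (by fun_prop)
    fun η => (mul_pos (walkSpeedDenom_pos θ) (walkSpeedDenom_pos η)).ne'

lemma norm_cexp_add_cexp_pow_le {z w : ℂ} (hz : ‖z‖ = 1) (hw : ‖w‖ = 1) (n : ℕ) :
    ‖z ^ n + w ^ n‖ ≤ 2 := by
  refine (norm_add_le _ _).trans ?_
  rw [norm_pow, norm_pow, hz, hw, one_pow]
  norm_num

lemma norm_walkCorrelation_oscillating_le (n : ℕ) (x : ℝ) :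
    ‖(-Complex.exp (-x * Complex.I)) ^ n + (-Complex.exp (x * Complex.I)) ^ n‖ ≤ 2 := by
  refine norm_cexp_add_cexp_pow_le ?_ ?_ n
  · rw [norm_neg, ← Complex.ofReal_neg, Complex.norm_exp_ofReal_mul_I]
  · rw [norm_neg, Complex.norm_exp_ofReal_mul_I]

lemma norm_walkCorrelation_le (n : ℕ) (θ η : ℝ) : ‖walkCorrelation n θ η‖ ≤ 6 := by
  have h1 : ‖Complex.exp ((walkPhase η - walkPhase θ : ℝ) * Complex.I) ^ n
      + Complex.exp (-(walkPhase η - walkPhase θ : ℝ) * Complex.I) ^ n‖ ≤ 2 := by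
    refine norm_cexp_add_cexp_pow_le ?_ ?_ n
    · rw [Complex.norm_exp_ofReal_mul_I]
    · rw [← Complex.ofReal_neg, Complex.norm_exp_ofReal_mul_I]
  have h2 := norm_walkCorrelation_oscillating_le n (walkPhase η + walkPhase θ)
  have h3 := abs_le.1 (abs_walkOverlap_le θ η)
  have h4 : ‖(1 + walkOverlap θ η : ℂ) / 2‖ ≤ 3 / 2 := by
    rw [norm_div, ← Complex.ofReal_one, ← Complex.ofReal_add, Complex.norm_real, Complex.norm_ofNat,
      Real.norm_eq_abs]
    gcongr
    exact abs_le.2 ⟨by linarith, by linarith⟩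
  have h5 : ‖(1 - walkOverlap θ η : ℂ) / 2‖ ≤ 3 / 2 := by
    rw [norm_div, ← Complex.ofReal_one, ← Complex.ofReal_sub, Complex.norm_real, Complex.norm_ofNat,
      Real.norm_eq_abs]
    gcongr
    exact abs_le.2 ⟨by linarith, by linarith⟩
  push_cast at h1 h2
  calc ‖walkCorrelation n θ η‖ ≤ 3 / 2 * 2 + 3 / 2 * 2 := by
        refine (norm_add_le _ _).trans ?_
        rw [norm_mul, norm_mul]
        gcongr
    _ = 6 := by norm_num

/-- Under ballistic rescaling the correlation converges pointwise. -/
theorem tendsto_walkCorrelation (t θ : ℝ) :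
    Tendsto (fun n : ℕ => walkCorrelation n θ (θ + t / n)) atTop
      (𝓝 (Complex.exp (t * walkVelocity θ * Complex.I)
        + Complex.exp (t * (-walkVelocity θ : ℝ) * Complex.I))) := by
  have hη : Tendsto (fun n : ℕ => θ + t / n) atTop (𝓝 θ) := by
    simpa using (tendsto_const_div_atTop_nhds_zero_nat t).const_add θ
  have hov : Tendsto (fun n : ℕ => (walkOverlap θ (θ + t / n) : ℂ)) atTop (𝓝 1) := by
    have := ((continuous_walkOverlap θ).tendsto θ).comp hη
    rw [walkOverlap_self] at this
    exact (Complex.continuous_ofReal.tendsto 1).comp this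
  have hphase : Tendsto (fun n : ℕ => n * (walkPhase (θ + t / n) - walkPhase θ)) atTop
      (𝓝 (t * walkVelocity θ)) := by
    have h := ((hasDerivAt_walkPhase (θ + t * 0)).comp (h := fun s => θ + t * s) (0 : ℝ)
      (((hasDerivAt_id (0 : ℝ)).const_mul t).const_add θ)).tendsto_slope_zero_right
    have h' := h.comp (tendsto_inv_atTop_nhdsGT_zero.comp tendsto_natCast_atTop_atTop)
    simpa [Function.comp_def, div_eq_mul_inv, mul_comm] using h'
  have hexp (s : ℝ) : Tendsto (fun n : ℕ =>
      Complex.exp (s * (walkPhase (θ + t / n) - walkPhase θ) * Complex.I) ^ n) atTop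
      (𝓝 (Complex.exp (s * (t * walkVelocity θ) * Complex.I))) := by
    have h := (Complex.continuous_ofReal.tendsto _).comp (hphase.const_mul s)
    have h' := (Complex.continuous_exp.tendsto _).comp (h.mul_const Complex.I)
    push_cast at h'
    refine h'.congr fun n => ?_
    simp only [Function.comp_apply, ← Complex.exp_nat_mul]
    push_cast
    ring_nf
  unfold walkCorrelation
  have hmain := ((hov.const_add 1).div_const 2).mul ((hexp 1).add (hexp (-1)))
  have hzero : Tendsto (fun n : ℕ => (1 - walkOverlap θ (θ + t / n) : ℂ) / 2 *
      ((-Complex.exp (-(walkPhase (θ + t / n) + walkPhase θ) * Complex.I)) ^ n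
        + (-Complex.exp ((walkPhase (θ + t / n) + walkPhase θ) * Complex.I)) ^ n)) atTop (𝓝 0) := by
    have h0 : Tendsto (fun n : ℕ => (1 - walkOverlap θ (θ + t / n) : ℂ) / 2) atTop (𝓝 0) := by
      simpa using (hov.const_sub 1).div_const 2
    refine h0.zero_mul_isBoundedUnder_le ⟨2, eventually_map.2 (.of_forall fun n => ?_)⟩
    have := norm_walkCorrelation_oscillating_le n (walkPhase (θ + t / n) + walkPhase θ)
    push_cast at this
    exact this
  have h := hmain.add hzero
  convert h using 2
  · simp
  · norm_num

lemma continuous_walkCorrelation_add (n : ℕ) (ε : ℝ) :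
    Continuous fun θ => walkCorrelation n θ (θ + ε) := by
  have : Continuous fun θ => walkOverlap θ (θ + ε) :=
    Continuous.div (by fun_prop) (by fun_prop)
      fun η => (mul_pos (walkSpeedDenom_pos _) (walkSpeedDenom_pos _)).ne'
  unfold walkCorrelation
  fun_prop

theorem tendsto_integral_walkCorrelation (t : ℝ) :
    Tendsto (fun n : ℕ => ∫ θ in (0)..(2 * Real.pi), walkCorrelation n θ (θ + t / n)) atTop
      (𝓝 (∫ θ in (0)..(2 * Real.pi), (Complex.exp (t * walkVelocity θ * Complex.I)
        + Complex.exp (t * (-walkVelocity θ : ℝ) * Complex.I)))) := by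
  refine intervalIntegral.tendsto_integral_filter_of_dominated_convergence (fun _ => 6)
    (.of_forall fun n => ?_) (.of_forall fun n => .of_forall fun θ _ => ?_)
    intervalIntegrable_const (.of_forall fun θ _ => tendsto_walkCorrelation t θ)
  · exact (continuous_walkCorrelation_add n _).aestronglyMeasurable
  · exact norm_walkCorrelation_le _ _ _

lemma walkVelocity_add_pi (θ : ℝ) : walkVelocity (θ + Real.pi) = -walkVelocity θ := by
  simp [walkVelocity, walkSpeedDenom, neg_div]

lemma walkVelocity_pi_sub (θ : ℝ) : walkVelocity (Real.pi - θ) = -walkVelocity θ := by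
  simp [walkVelocity, walkSpeedDenom, neg_div]

/-- The distribution of the group velocity over a period can be computed on a half period. -/
lemma integral_walkVelocity_symm {F : ℝ → ℂ} (hF : Continuous F) :
    ∫ θ in (0)..(2 * Real.pi), (F (walkVelocity θ) + F (-walkVelocity θ))
      = 4 * ∫ θ in (0)..Real.pi, F (walkVelocity θ) := by
  have hc : Continuous fun θ => F (walkVelocity θ) := by fun_prop
  have hc' : Continuous fun θ => F (-walkVelocity θ) := by fun_prop
  have h1 : ∫ θ in (0)..Real.pi, F (-walkVelocity θ) = ∫ θ in (0)..Real.pi, F (walkVelocity θ) := by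
    simp_rw [← walkVelocity_pi_sub]
    simpa using intervalIntegral.integral_comp_sub_left (a := 0) (b := Real.pi)
      (fun θ => F (walkVelocity θ)) Real.pi
  have h2 : ∫ θ in Real.pi..(2 * Real.pi), (F (walkVelocity θ) + F (-walkVelocity θ))
      = ∫ θ in (0)..Real.pi, (F (walkVelocity θ) + F (-walkVelocity θ)) := by
    have := intervalIntegral.integral_comp_add_right (a := 0) (b := Real.pi)
      (fun θ => F (walkVelocity θ) + F (-walkVelocity θ)) Real.pi
    simp only [walkVelocity_add_pi, neg_neg, zero_add, ← two_mul] at this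
    rw [← this]
    simp_rw [add_comm]
  have hadd : Continuous fun θ => F (walkVelocity θ) + F (-walkVelocity θ) := hc.add hc'
  rw [← intervalIntegral.integral_add_adjacent_intervals (b := Real.pi)
    (hadd.intervalIntegrable _ _) (hadd.intervalIntegrable _ _), h2,
    intervalIntegral.integral_add (hc.intervalIntegrable _ _) (hc'.intervalIntegrable _ _), h1]
  ring

lemma hasDerivAt_walkVelocity (θ : ℝ) :
    HasDerivAt walkVelocity (-Real.sin θ / walkSpeedDenom θ ^ 3) θ := by
  have h0 := walkSpeedDenom_pos θ
  have hsq := walkSpeedDenom_sq θ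
  have hD : HasDerivAt walkSpeedDenom (-(Real.cos θ * Real.sin θ) / walkSpeedDenom θ) θ := by
    have hpos : 1 + (Real.cos ^ 2) θ ≠ 0 := by
      rw [Pi.pow_apply]; positivity
    have := (((Real.hasDerivAt_cos θ).pow 2).const_add 1).sqrt hpos
    refine this.congr_deriv ?_
    change _ / (2 * walkSpeedDenom θ) = _
    field_simp
    push_cast
    ring
  refine ((Real.hasDerivAt_cos θ).div hD h0.ne').congr_deriv ?_
  field_simp
  linear_combination (-Real.sin θ) * hsq

lemma strictAntiOn_walkVelocity : StrictAntiOn walkVelocity (Set.Icc 0 Real.pi) := by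
  refine strictAntiOn_of_deriv_neg (convex_Icc _ _) continuous_walkVelocity.continuousOn ?_
  intro θ hθ
  rw [interior_Icc] at hθ
  rw [(hasDerivAt_walkVelocity θ).deriv]
  have := Real.sin_pos_of_pos_of_lt_pi hθ.1 hθ.2
  have := walkSpeedDenom_pos θ
  exact div_neg_of_neg_of_pos (by linarith) (by positivity)

lemma walkVelocity_image_Ioo :
    walkVelocity '' Set.Ioo 0 Real.pi = Set.Ioo (-(1 / Real.sqrt 2)) (1 / Real.sqrt 2) := by
  have h0 : walkVelocity 0 = 1 / Real.sqrt 2 := by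
    simp [walkVelocity, walkSpeedDenom]; norm_num
  have hpi : walkVelocity Real.pi = -(1 / Real.sqrt 2) := by
    rw [← h0, ← walkVelocity_add_pi, zero_add]
  rw [← hpi, ← h0]
  refine Set.Subset.antisymm ?_
    (intermediate_value_Ioo' Real.pi_pos.le continuous_walkVelocity.continuousOn)
  rintro _ ⟨θ, hθ, rfl⟩
  exact ⟨strictAntiOn_walkVelocity ⟨hθ.1.le, hθ.2.le⟩ ⟨Real.pi_pos.le, le_rfl⟩ hθ.2,
    strictAntiOn_walkVelocity ⟨le_rfl, Real.pi_pos.le⟩ ⟨hθ.1.le, hθ.2.le⟩ hθ.1⟩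

lemma konno_walkVelocity {θ : ℝ} (hθ : θ ∈ Set.Ioo 0 Real.pi) :
    konno (walkVelocity θ) = walkSpeedDenom θ ^ 3 / (Real.pi * Real.sin θ) := by
  have hmem : walkVelocity θ ∈ Set.Ioo (-(1 / Real.sqrt 2)) (1 / Real.sqrt 2) :=
    walkVelocity_image_Ioo ▸ Set.mem_image_of_mem _ hθ
  have hs := Real.sin_pos_of_pos_of_lt_pi hθ.1 hθ.2
  have h0 := walkSpeedDenom_pos θ
  have hsq := walkSpeedDenom_sq θ
  have hcs := Real.sin_sq_add_cos_sq θ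
  have h1 : 1 - walkVelocity θ ^ 2 = 1 / walkSpeedDenom θ ^ 2 := by
    rw [walkVelocity]; field_simp; linarith
  have h2 : 1 - 2 * walkVelocity θ ^ 2 = (Real.sin θ / walkSpeedDenom θ) ^ 2 := by
    rw [walkVelocity]; field_simp; linarith
  rw [konno, if_pos (abs_lt.2 hmem), h1, h2, Real.sqrt_sq (by positivity)]
  have := Real.pi_pos
  field_simp

theorem integral_mul_konno (g : ℝ → ℝ) :
    ∫ y, g y * konno y = Real.pi⁻¹ * ∫ θ in Set.Ioo 0 Real.pi, g (walkVelocity θ) := by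
  have hsupp : ∫ y in Set.Ioo (-(1 / Real.sqrt 2)) (1 / Real.sqrt 2), g y * konno y
      = ∫ y, g y * konno y := by
    refine setIntegral_eq_integral_of_forall_compl_eq_zero fun y hy => ?_
    rw [konno, if_neg (fun h => hy (abs_lt.1 h)), mul_zero]
  rw [← hsupp, ← walkVelocity_image_Ioo, integral_image_eq_integral_abs_deriv_smul
    measurableSet_Ioo (fun θ _ => (hasDerivAt_walkVelocity θ).hasDerivWithinAt)
    (strictAntiOn_walkVelocity.injOn.mono Set.Ioo_subset_Icc_self), ← integral_const_mul]
  refine setIntegral_congr_fun measurableSet_Ioo fun θ hθ => ?_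
  have hs := Real.sin_pos_of_pos_of_lt_pi hθ.1 hθ.2
  have h0 := walkSpeedDenom_pos θ
  simp only [smul_eq_mul]
  rw [konno_walkVelocity hθ, abs_div, abs_neg, abs_of_pos hs, abs_of_pos (by positivity)]
  field_simp

lemma integral_haarAddCircle_eq_intervalIntegral (f : AddCircle (2 * Real.pi) → ℂ) :
    ∫ x, f x ∂haarAddCircle
      = (2 * Real.pi : ℂ)⁻¹ * ∫ θ in (0)..(2 * Real.pi), f (θ : AddCircle (2 * Real.pi)) := by
  have h := AddCircle.intervalIntegral_preimage (2 * Real.pi) 0 f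
  rw [zero_add] at h
  rw [h, integral_haarAddCircle, Complex.real_smul]
  push_cast
  rfl

/-- The characteristic function of the position distribution, in terms of the symbol. -/
theorem hasSum_transition_mul_exp (U : QWState →ₗ[ℂ] QWState)
    (hU : ∀ (ψ : QWState) (k : ℤ),
      (U ψ) k 0 = (ψ (k - 1) 0 + ψ (k - 1) 1) / (Real.sqrt 2 : ℂ) ∧
      (U ψ) k 1 = (ψ (k + 1) 0 - ψ (k + 1) 1) / (Real.sqrt 2 : ℂ))
    (p : ℕ → ℤ → ℤ → ℝ)
    (hp : ∀ (n : ℕ) (k j : ℤ), p n k j =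
      (1 / 2) * ‖((U ^ n) (deltaCoin k 0)) j‖ ^ 2
        + (1 / 2) * ‖((U ^ n) (deltaCoin k 1)) j‖ ^ 2)
    (n : ℕ) (ε : ℝ) :
    HasSum (fun j : ℤ => (p n 0 j : ℂ) * Complex.exp (ε * j * Complex.I))
      ((4 * Real.pi : ℂ)⁻¹ * ∫ θ in (0)..(2 * Real.pi), walkCorrelation n θ (θ + ε)) := by
  have h := (hasSum_sum (s := Finset.univ) fun c (_ : c ∈ Finset.univ) =>
    hasSum_sum (s := Finset.univ) fun d (_ : d ∈ Finset.univ) =>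
      hasSum_sq_fourierCoeff_mul_exp ((walkSymbol ^ n) d c) ε).mul_left (1 / 2 : ℂ)
  have hterm : ∀ j : ℤ, (p n 0 j : ℂ) * Complex.exp (ε * j * Complex.I)
      = 1 / 2 * ∑ c, ∑ d, ((‖fourierCoeff ((walkSymbol ^ n) d c) j‖ ^ 2 : ℝ) : ℂ)
        * Complex.exp (ε * j * Complex.I) := by
    intro j
    simp only [hp, EuclideanSpace.norm_sq_eq, Fin.sum_univ_two,
      amplitude_eq_fourierCoeff U hU]
    push_cast
    ring
  simp_rw [hterm]
  have hint (c d : Fin 2) : Integrable (fun x => conj ((walkSymbol ^ n) d c x) *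
      (walkSymbol ^ n) d c (x + (ε : AddCircle (2 * Real.pi)))) haarAddCircle :=
    integrable_continuousMap ⟨fun x => conj ((walkSymbol ^ n) d c x) *
      (walkSymbol ^ n) d c (x + (ε : AddCircle (2 * Real.pi))), by fun_prop⟩
  have hswap : ∑ c, ∑ d, ∫ x, conj ((walkSymbol ^ n) d c x) *
      (walkSymbol ^ n) d c (x + (ε : AddCircle (2 * Real.pi))) ∂haarAddCircle
      = ∫ x, ∑ c, ∑ d, conj ((walkSymbol ^ n) d c x) *
      (walkSymbol ^ n) d c (x + (ε : AddCircle (2 * Real.pi))) ∂haarAddCircle := by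
    rw [integral_finsetSum _ fun c _ => integrable_finsetSum _ fun d _ => hint c d]
    exact Finset.sum_congr rfl fun c _ => (integral_finsetSum _ fun d _ => hint c d).symm
  rw [hswap, integral_haarAddCircle_eq_intervalIntegral] at h
  simp_rw [← AddCircle.coe_add, sum_conj_walkSymbol_pow] at h
  have hconst : (4 * Real.pi : ℂ)⁻¹ = 1 / 2 * (2 * Real.pi : ℂ)⁻¹ := by
    rw [mul_inv, mul_inv]; ring
  rwa [hconst, mul_assoc]

/-- The limiting distribution, as the law of the group velocity of a uniform random phase. -/
def konnoMeasure : Measure ℝ :=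
  (ENNReal.ofReal Real.pi⁻¹ • volume.restrict (Set.Ioo 0 Real.pi)).map walkVelocity

instance isProbabilityMeasure_konnoMeasure : IsProbabilityMeasure konnoMeasure := by
  have : IsProbabilityMeasure
      (ENNReal.ofReal Real.pi⁻¹ • volume.restrict (Set.Ioo 0 Real.pi)) := by
    constructor
    rw [Measure.smul_apply, Measure.restrict_apply_univ, Real.volume_Ioo, sub_zero, smul_eq_mul,
      ← ENNReal.ofReal_mul (by positivity), inv_mul_cancel₀ Real.pi_ne_zero, ENNReal.ofReal_one]
  exact Measure.isProbabilityMeasure_map continuous_walkVelocity.aemeasurable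

lemma integral_konnoMeasure {E : Type*} [NormedAddCommGroup E] [NormedSpace ℝ E] {F : ℝ → E}
    (hF : StronglyMeasurable F) :
    ∫ y, F y ∂konnoMeasure = Real.pi⁻¹ • ∫ θ in Set.Ioo 0 Real.pi, F (walkVelocity θ) := by
  rw [konnoMeasure, integral_map continuous_walkVelocity.aemeasurable
    hF.aestronglyMeasurable, integral_smul_measure, ENNReal.toReal_ofReal (by positivity)]

/-- **Law of large numbers for the Hadamard quantum random walk** started from the origin
with uniformly mixed coin. Let `U` be the Hadamard quantum walk operator on `ℓ²(ℤ; ℂ²)`,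
defined coordinatewise by `(Uψ)₊(k) = (ψ₊(k−1) + ψ₋(k−1))/√2` and
`(Uψ)₋(k) = (ψ₊(k+1) − ψ₋(k+1))/√2`, and set
`pₙ(k, j) := ½‖(Uⁿ(δ_k ⊗ +))(j)‖² + ½‖(Uⁿ(δ_k ⊗ −))(j)‖²`. Then for every bounded
continuous `g : ℝ → ℝ`, `lim_{n→∞} Σ_{j∈ℤ} pₙ(0, j) g(j/n) = ∫_ℝ g(y) f(y) dy`,
i.e. the rescaled position distribution converges weakly to the measure with density `f`. -/
theorem hadamard_walk_law_of_large_numbers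
    (U : QWState →ₗ[ℂ] QWState)
    (hU : ∀ (ψ : QWState) (k : ℤ),
      (U ψ) k 0 = (ψ (k - 1) 0 + ψ (k - 1) 1) / (Real.sqrt 2 : ℂ) ∧
      (U ψ) k 1 = (ψ (k + 1) 0 - ψ (k + 1) 1) / (Real.sqrt 2 : ℂ))
    (p : ℕ → ℤ → ℤ → ℝ)
    (hp : ∀ (n : ℕ) (k j : ℤ), p n k j =
      (1 / 2) * ‖((U ^ n) (deltaCoin k 0)) j‖ ^ 2
        + (1 / 2) * ‖((U ^ n) (deltaCoin k 1)) j‖ ^ 2)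
    (g : ℝ → ℝ) (hgcont : Continuous g) (hgbdd : ∃ C : ℝ, ∀ x, |g x| ≤ C) :
    Tendsto (fun n : ℕ => ∑' j : ℤ, p n 0 j * g ((j : ℝ) / (n : ℝ))) atTop
      (𝓝 (∫ y : ℝ, g y * konno y)) := by
  have hchar := hasSum_transition_mul_exp U hU p hp
  have hpi : (Real.pi : ℂ) ≠ 0 := by exact_mod_cast Real.pi_ne_zero
  have hnonneg (n : ℕ) (j : ℤ) : 0 ≤ p n 0 j := by rw [hp]; positivity
  have hsum (n : ℕ) : HasSum (p n 0) 1 := by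
    rw [← Complex.hasSum_ofReal]
    have h := hchar n 0
    simp only [add_zero, walkCorrelation_self, Complex.ofReal_zero, zero_mul, Complex.exp_zero,
      mul_one, intervalIntegral.integral_const, sub_zero, Complex.real_smul] at h
    convert h using 1
    push_cast
    field_simp
    norm_num
  let P (n : ℕ) : PMF ℤ := ⟨fun j => ENNReal.ofReal (p n 0 j),
    (Summable.hasSum_iff ENNReal.summable).2 <| by
      rw [← ENNReal.ofReal_tsum_of_nonneg (hnonneg n) (hsum n).summable, (hsum n).tsum_eq,
        ENNReal.ofReal_one]⟩
  have hmeas (n : ℕ) : Measurable fun j : ℤ => (j : ℝ) / n := Measurable.of_discrete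
  let μ (n : ℕ) : ProbabilityMeasure ℝ := ⟨(P n).toMeasure.map fun j : ℤ => (j : ℝ) / n,
    Measure.isProbabilityMeasure_map (hmeas n).aemeasurable⟩
  have hμ {E : Type} [NormedAddCommGroup E] [NormedSpace ℝ E] [CompleteSpace E] (n : ℕ)
      (F : ℝ → E) (hF : StronglyMeasurable F) (C : ℝ) (hC : ∀ x, ‖F x‖ ≤ C) :
      ∫ x, F x ∂(μ n : Measure ℝ) = ∑' j : ℤ, p n 0 j • F ((j : ℝ) / n) := by
    change ∫ x, F x ∂((P n).toMeasure.map fun j : ℤ => (j : ℝ) / n) = _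
    rw [integral_map (hmeas n).aemeasurable hF.aestronglyMeasurable, PMF.integral_eq_tsum]
    · exact tsum_congr fun j => by
        rw [show P n j = ENNReal.ofReal (p n 0 j) from rfl, ENNReal.toReal_ofReal (hnonneg n j)]
    · exact Integrable.of_bound (hF.comp_measurable (hmeas n)).aestronglyMeasurable C
        (.of_forall fun j => hC _)
  have hlim : Tendsto μ atTop (𝓝 ⟨konnoMeasure, inferInstance⟩) := by
    refine ProbabilityMeasure.tendsto_iff_tendsto_charFun.2 fun t => ?_
    have hcont : Continuous fun x : ℝ => Complex.exp (t * x * Complex.I) := by fun_prop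
    have hleft (n : ℕ) : charFun (μ n : Measure ℝ) t = (4 * Real.pi : ℂ)⁻¹ *
        ∫ θ in (0)..(2 * Real.pi), walkCorrelation n θ (θ + t / n) := by
      rw [charFun_apply_real, hμ n _ hcont.stronglyMeasurable 1, ← (hchar n (t / n)).tsum_eq]
      · refine tsum_congr fun j => ?_
        rw [Complex.real_smul]
        push_cast
        ring_nf
      · intro x
        rw [← Complex.ofReal_mul, Complex.norm_exp_ofReal_mul_I]
    have hright : charFun konnoMeasure t = (4 * Real.pi : ℂ)⁻¹ *
        ∫ θ in (0)..(2 * Real.pi), (Complex.exp (t * walkVelocity θ * Complex.I)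
          + Complex.exp (t * (-walkVelocity θ : ℝ) * Complex.I)) := by
      rw [charFun_apply_real, integral_konnoMeasure hcont.stronglyMeasurable,
        integral_walkVelocity_symm hcont, intervalIntegral.integral_of_le Real.pi_pos.le,
        integral_Ioc_eq_integral_Ioo, Complex.real_smul, ← mul_assoc]
      congr 1
      push_cast
      field_simp
    simp_rw [hleft]
    change Tendsto _ _ (𝓝 (charFun konnoMeasure t))
    rw [hright]
    exact (tendsto_integral_walkCorrelation t).const_mul _
  obtain ⟨C, hC⟩ := hgbdd
  have h := ProbabilityMeasure.tendsto_iff_forall_integral_tendsto.1 hlim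
    (BoundedContinuousFunction.ofNormedAddCommGroup g hgcont C hC)
  simp only [BoundedContinuousFunction.coe_ofNormedAddCommGroup,
    hμ _ g hgcont.stronglyMeasurable C hC] at h
  rw [integral_mul_konno]
  change Tendsto _ _ (𝓝 (∫ y, g y ∂konnoMeasure)) at h
  rw [integral_konnoMeasure hgcont.stronglyMeasurable] at h
  exact h

end
end

section
/- Convergence of the local Poisson parameters: let γ : ℝ → ℝ≥0 be continuous with compact support, let t > 0 and x ∈ ℝ. Then lim_{n→∞} Σ_{k∈ℤ} γ(k/n) p_{⌊tn⌋}(⌊xn⌋, k) = ρ(t, x), where ρ(t, x) = (γ * f_t)(x) = ∫_ℝ γ(y)(1/t) f((x−y)/t) dy. -/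
open Filter
open scoped ENNReal Topology

noncomputable section

open MeasureTheory Complex
open scoped Real ComplexConjugate

/-- The Fourier symbol of the Hadamard walk operator. -/
def hadamardSymbol (θ : ℝ) : Matrix (Fin 2) (Fin 2) ℂ :=
  !![exp (θ * I) / (√2 : ℝ), exp (θ * I) / (√2 : ℝ);
    exp (-(θ * I)) / (√2 : ℝ), -(exp (-(θ * I)) / (√2 : ℝ))]

/-- The phase `ω` such that `I * exp (± I * ω)` are the eigenvalues of the symbol. -/
def phase (θ : ℝ) : ℝ := Real.arccos (Real.sin θ / √2)

/-- The normalising factor `√(1 + cos² θ) = √2 * sin (phase θ)`. -/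
def phaseNorm (θ : ℝ) : ℝ := √(1 + Real.cos θ ^ 2)

/-- The group velocity of the walk, that is, minus the derivative of the phase. -/
def velocity (θ : ℝ) : ℝ := Real.cos θ / phaseNorm θ

lemma phaseNorm_sq (θ : ℝ) : phaseNorm θ ^ 2 = 1 + Real.cos θ ^ 2 :=
  Real.sq_sqrt (by positivity)

lemma one_le_phaseNorm (θ : ℝ) : 1 ≤ phaseNorm θ :=
  Real.one_le_sqrt.2 (by nlinarith [sq_nonneg (Real.cos θ)])

lemma phaseNorm_pos (θ : ℝ) : 0 < phaseNorm θ := one_pos.trans_le (one_le_phaseNorm θ)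

lemma abs_sin_div_sqrt_two_lt (θ : ℝ) : |Real.sin θ / √2| < 1 := by
  rw [← sq_lt_one_iff_abs_lt_one, div_pow, Real.sq_sqrt zero_le_two]
  nlinarith [Real.sin_sq_le_one θ]

lemma cos_phase (θ : ℝ) : Real.cos (phase θ) = Real.sin θ / √2 :=
  have h := abs_lt.1 (abs_sin_div_sqrt_two_lt θ)
  Real.cos_arccos h.1.le h.2.le

lemma sin_phase (θ : ℝ) : Real.sin (phase θ) = phaseNorm θ / √2 := by
  rw [phase, Real.sin_arccos, phaseNorm, ← Real.sqrt_div (by positivity)]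
  congr 1
  rw [div_pow, Real.sq_sqrt zero_le_two, Real.sin_sq]
  ring

lemma continuous_phaseNorm : Continuous phaseNorm := by
  unfold phaseNorm; fun_prop

lemma continuous_velocity : Continuous velocity :=
  Real.continuous_cos.div continuous_phaseNorm fun θ => (phaseNorm_pos θ).ne'

lemma continuous_phase : Continuous phase := by
  unfold phase; fun_prop

lemma hasDerivAt_phase (θ : ℝ) : HasDerivAt phase (-velocity θ) θ := by
  have h := abs_lt.1 (abs_sin_div_sqrt_two_lt θ)
  have h1 := (Real.hasDerivAt_arccos h.1.ne' h.2.ne).comp θ ((Real.hasDerivAt_sin θ).div_const √2)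
  have := phaseNorm_pos θ
  have h2 : -velocity θ = -(1 / √(1 - (Real.sin θ / √2) ^ 2)) * (Real.cos θ / √2) := by
    rw [← Real.sin_arccos, ← phase, sin_phase, velocity]
    field_simp
  rw [h2]
  exact h1

/-- The traceless part of the symbol. -/
def symbolTraceless (θ : ℝ) : Matrix (Fin 2) (Fin 2) ℂ :=
  !![(Real.cos θ : ℂ), exp (θ * I); exp (-(θ * I)), -(Real.cos θ : ℂ)]

lemma symbolTraceless_mul_self (θ : ℝ) :
    symbolTraceless θ * symbolTraceless θ = ((phaseNorm θ : ℂ) ^ 2) • 1 := by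
  have h : exp (θ * I) * exp (-(θ * I)) = 1 := by rw [← exp_add]; simp
  have h2 : (phaseNorm θ : ℂ) ^ 2 = 1 + (Real.cos θ : ℂ) ^ 2 := by
    exact_mod_cast congrArg ofReal (phaseNorm_sq θ)
  rw [h2]
  ext i j
  fin_cases i <;> fin_cases j <;>
    simp [symbolTraceless, Matrix.mul_apply, Fin.sum_univ_two, -ofReal_cos] <;>
    first | ring1 | linear_combination h

lemma hadamardSymbol_eq (θ : ℝ) : hadamardSymbol θ =
    I • ((Real.cos (phase θ) : ℂ) • 1 -
      (I * Real.sin (phase θ) / phaseNorm θ) • symbolTraceless θ) := by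
  have hn : (phaseNorm θ : ℂ) ≠ 0 := ofReal_ne_zero.2 (phaseNorm_pos θ).ne'
  have h2 : ((√2 : ℝ) : ℂ) ≠ 0 := ofReal_ne_zero.2 (by positivity)
  have e1 : exp (θ * I) = Real.cos θ + Real.sin θ * I := by
    rw [exp_mul_I]; push_cast; rfl
  have e2 : exp (-(θ * I)) = Real.cos θ - Real.sin θ * I := by
    rw [← neg_mul, exp_mul_I, Complex.cos_neg, Complex.sin_neg]; push_cast; ring
  rw [cos_phase, sin_phase]
  ext i j
  fin_cases i <;> fin_cases j <;>
    simp only [hadamardSymbol, symbolTraceless, e1, e2, ofReal_div] <;>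
    simp [-ofReal_cos, -ofReal_sin] <;> field_simp
  · linear_combination (Real.cos θ : ℂ) * I_sq
  · linear_combination (Real.cos θ + Real.sin θ * I) * I_sq
  · linear_combination (Real.cos θ - Real.sin θ * I) * I_sq
  · linear_combination (-Real.cos θ : ℂ) * I_sq

lemma hadamardSymbol_pow (θ : ℝ) (m : ℕ) : hadamardSymbol θ ^ m =
    I ^ m • ((Real.cos (m * phase θ) : ℂ) • 1 -
      (I * Real.sin (m * phase θ) / phaseNorm θ) • symbolTraceless θ) := by
  have hn : (phaseNorm θ : ℂ) ≠ 0 := ofReal_ne_zero.2 (phaseNorm_pos θ).ne'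
  induction m with
  | zero => simp
  | succ m ih =>
    have hc : Real.cos (((m + 1 : ℕ) : ℝ) * phase θ) =
        Real.cos (m * phase θ) * Real.cos (phase θ) -
          Real.sin (m * phase θ) * Real.sin (phase θ) := by
      rw [← Real.cos_add]; push_cast; ring_nf
    have hs : Real.sin (((m + 1 : ℕ) : ℝ) * phase θ) =
        Real.sin (m * phase θ) * Real.cos (phase θ) +
          Real.cos (m * phase θ) * Real.sin (phase θ) := by
      rw [← Real.sin_add]; push_cast; ring_nf
    rw [pow_succ, ih, hadamardSymbol_eq, hc, hs]
    simp only [Matrix.smul_mul, Matrix.mul_smul, sub_mul, mul_sub, symbolTraceless_mul_self,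
      one_mul, mul_one, smul_smul, smul_sub, ofReal_add, ofReal_sub, ofReal_mul]
    match_scalars
    · field_simp
      linear_combination (I * I ^ m * Complex.sin (phase θ) * Complex.sin (m * phase θ)) * I_sq
    · field_simp
      ring

/-- Half the trace of `(hadamardSymbol θ ^ m)ᴴ * hadamardSymbol θ' ^ m`. -/
def symbolKernel (m : ℕ) (θ θ' : ℝ) : ℝ :=
  Real.cos (m * phase θ) * Real.cos (m * phase θ') +
    Real.sin (m * phase θ) * Real.sin (m * phase θ') *
      ((Real.cos θ * Real.cos θ' + Real.cos (θ' - θ)) / (phaseNorm θ * phaseNorm θ'))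

lemma sum_conj_hadamardSymbol_pow_mul (m : ℕ) (θ θ' : ℝ) :
    ∑ c, ∑ d, conj ((hadamardSymbol θ ^ m) d c) * (hadamardSymbol θ' ^ m) d c =
      2 * (symbolKernel m θ θ' : ℂ) := by
  have hn : (phaseNorm θ : ℂ) ≠ 0 := ofReal_ne_zero.2 (phaseNorm_pos θ).ne'
  have hn' : (phaseNorm θ' : ℂ) ≠ 0 := ofReal_ne_zero.2 (phaseNorm_pos θ').ne'
  have hI : conj I ^ m * I ^ m = 1 := by rw [← mul_pow]; simp
  have e1 (θ : ℝ) : exp (θ * I) = Real.cos θ + Real.sin θ * I := by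
    rw [exp_mul_I]; push_cast; rfl
  have e2 (θ : ℝ) : exp (-(θ * I)) = Real.cos θ - Real.sin θ * I := by
    rw [← neg_mul, exp_mul_I, Complex.cos_neg, Complex.sin_neg]; push_cast; ring
  have key (A B : Matrix (Fin 2) (Fin 2) ℂ) :
      ∑ c, ∑ d, conj ((I ^ m • A) d c) * (I ^ m • B) d c = ∑ c, ∑ d, conj (A d c) * B d c := by
    refine Finset.sum_congr rfl fun c _ => Finset.sum_congr rfl fun d _ => ?_
    simp only [Matrix.smul_apply, smul_eq_mul, map_mul, map_pow]
    linear_combination (conj (A d c) * B d c) * hI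
  rw [hadamardSymbol_pow, hadamardSymbol_pow, key, symbolKernel, Real.cos_sub]
  generalize (m : ℝ) * phase θ = a
  generalize (m : ℝ) * phase θ' = b
  simp only [Fin.sum_univ_two, symbolTraceless, e1, e2]
  simp [-ofReal_cos, -ofReal_sin]
  field_simp
  ring_nf
  simp only [I_sq, I_pow_four]
  ring

/-- `U` acts on `ℓ²(ℤ; ℂ²)` as the Hadamard quantum walk operator. -/
def IsHadamardWalk (U : QWState →ₗ[ℂ] QWState) : Prop :=
  ∀ (ψ : QWState) (k : ℤ),
    (U ψ) k 0 = (ψ (k - 1) 0 + ψ (k - 1) 1) / (Real.sqrt 2 : ℂ) ∧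
    (U ψ) k 1 = (ψ (k + 1) 0 - ψ (k + 1) 1) / (Real.sqrt 2 : ℂ)

lemma hasSum_fourier_step {U : QWState →ₗ[ℂ] QWState} (hU : IsHadamardWalk U)
    (ψ : QWState) (θ : ℝ) (F : Fin 2 → ℂ)
    (hF : ∀ d, HasSum (fun j : ℤ => ψ j d * exp (j * θ * I)) (F d)) (d : Fin 2) :
    HasSum (fun j : ℤ => (U ψ) j d * exp (j * θ * I))
      (hadamardSymbol θ d 0 * F 0 + hadamardSymbol θ d 1 * F 1) := by
  revert d
  refine Fin.forall_fin_two.2 ⟨?_, ?_⟩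
  · have h := (((Equiv.subRight (1 : ℤ)).hasSum_iff.2 ((hF 0).add (hF 1))).mul_left
      (exp (θ * I) / (√2 : ℝ)))
    convert! h using 1
    · funext j
      simp only [(hU ψ j).1, Function.comp_apply, Equiv.subRight_apply]
      have : exp (j * θ * I) = exp (θ * I) * exp (((j - 1 : ℤ) : ℂ) * θ * I) := by
        rw [← exp_add]; push_cast; ring_nf
      rw [this]
      ring
    · simp [hadamardSymbol]
      ring
  · have h := (((Equiv.addRight (1 : ℤ)).hasSum_iff.2 ((hF 0).sub (hF 1))).mul_left
      (exp (-(θ * I)) / (√2 : ℝ)))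
    convert! h using 1
    · funext j
      simp only [(hU ψ j).2, Function.comp_apply, Equiv.coe_addRight]
      have : exp (j * θ * I) = exp (-(θ * I)) * exp (((j + 1 : ℤ) : ℂ) * θ * I) := by
        rw [← exp_add]; push_cast; ring_nf
      rw [this]
      ring
    · simp [hadamardSymbol]
      ring

lemma hasSum_fourier {U : QWState →ₗ[ℂ] QWState} (hU : IsHadamardWalk U)
    (k : ℤ) (c : Fin 2) (θ : ℝ) (m : ℕ) (d : Fin 2) :
    HasSum (fun j : ℤ => ((U ^ m) (deltaCoin k c)) j d * exp (j * θ * I))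
      ((hadamardSymbol θ ^ m) d c * exp (k * θ * I)) := by
  induction m generalizing d with
  | zero =>
    convert hasSum_single (f := fun j : ℤ => ((U ^ 0) (deltaCoin k c)) j d * exp (j * θ * I)) k
      fun j hj => ?_ using 1
    · simp [deltaCoin, Matrix.one_apply]
    · simp [deltaCoin, hj]
  | succ m ih =>
    convert hasSum_fourier_step hU _ θ _ ih d using 1
    · simp only [pow_succ', Module.End.mul_apply]
    · rw [pow_succ', Matrix.mul_apply, Fin.sum_univ_two]
      ring

lemma exists_finset_support {U : QWState →ₗ[ℂ] QWState} (hU : IsHadamardWalk U)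
    (k : ℤ) (c : Fin 2) (m : ℕ) :
    ∃ s : Finset ℤ, ∀ j ∉ s, ((U ^ m) (deltaCoin k c)) j = 0 := by
  induction m with
  | zero => exact ⟨{k}, fun j hj => by simpa [deltaCoin, Pi.single_apply] using hj⟩
  | succ m ih =>
    obtain ⟨s, hs⟩ := ih
    refine ⟨s.image (· + 1) ∪ s.image (· - 1), fun j hj => ?_⟩
    have h1 : j - 1 ∉ s := fun h =>
      hj (Finset.mem_union_left _ (Finset.mem_image.2 ⟨_, h, by ring⟩))
    have h2 : j + 1 ∉ s := fun h =>
      hj (Finset.mem_union_right _ (Finset.mem_image.2 ⟨_, h, by ring⟩))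
    rw [pow_succ', Module.End.mul_apply]
    ext d
    fin_cases d
    · simp [(hU _ j).1, hs _ h1]
    · simp [(hU _ j).2, hs _ h2]

lemma integral_exp_int_mul_I (n : ℤ) :
    ∫ θ in (0 : ℝ)..2 * π, exp (n * θ * I) = if n = 0 then 2 * (π : ℂ) else 0 := by
  split_ifs with h
  · simp [h]
  · have hc : (n : ℂ) * I ≠ 0 := by simp [h]
    have := integral_exp_mul_complex (a := 0) (b := 2 * π) hc
    simp only [mul_right_comm _ I] at this
    rw [this]
    have h1 : exp (n * ((2 * π : ℝ) : ℂ) * I) = 1 := by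
      rw [← exp_int_mul_two_pi_mul_I n]; push_cast; ring_nf
    rw [h1]
    simp

/-- Parseval's identity for a trigonometric polynomial and its translate by `ξ`. -/
lemma integral_conj_mul_translate (a : ℤ → ℂ) (s : Finset ℤ) (ξ : ℝ) :
    ∫ θ in (0 : ℝ)..2 * π, conj (∑ j ∈ s, a j * exp (j * θ * I)) *
        ∑ j ∈ s, a j * exp (j * (θ + ξ : ℝ) * I) =
      2 * π * ∑ j ∈ s, (‖a j‖ : ℂ) ^ 2 * exp (j * ξ * I) := by
  have h (θ : ℝ) : conj (∑ j ∈ s, a j * exp (j * θ * I)) *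
        ∑ j ∈ s, a j * exp (j * (θ + ξ : ℝ) * I) =
      ∑ i ∈ s, ∑ j ∈ s, conj (a i) * a j * exp (j * ξ * I) * exp ((j - i : ℤ) * θ * I) := by
    rw [map_sum, Finset.sum_mul_sum]
    refine Finset.sum_congr rfl fun i _ => Finset.sum_congr rfl fun j _ => ?_
    have : exp (j * (θ + ξ : ℝ) * I) * exp (-(i * θ * I)) =
        exp (j * ξ * I) * exp ((j - i : ℤ) * θ * I) := by
      rw [← exp_add, ← exp_add]; push_cast; ring_nf
    rw [map_mul, ← exp_conj]
    simp only [map_mul, conj_ofReal, conj_I, map_intCast, mul_neg]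
    linear_combination (conj (a i) * a j) * this
  simp_rw [h]
  rw [intervalIntegral.integral_finsetSum fun i _ =>
    Continuous.intervalIntegrable (by fun_prop) _ _]
  rw [Finset.mul_sum]
  refine Finset.sum_congr rfl fun i hi => ?_
  rw [intervalIntegral.integral_finsetSum fun i _ =>
    Continuous.intervalIntegrable (by fun_prop) _ _]
  simp_rw [intervalIntegral.integral_const_mul, integral_exp_int_mul_I, sub_eq_zero]
  simp only [mul_ite, mul_zero, Finset.sum_ite_eq', hi, if_true]
  rw [← conj_mul']
  ring

/-- The characteristic function of the position of the walk started at `k`. -/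
lemma sum_transition_mul_exp {U : QWState →ₗ[ℂ] QWState} (hU : IsHadamardWalk U)
    (m : ℕ) (k : ℤ) (s : Finset ℤ)
    (hs : ∀ c, ∀ j ∉ s, ((U ^ m) (deltaCoin k c)) j = 0) (ξ : ℝ) :
    ∑ j ∈ s, (((1 / 2) * ‖((U ^ m) (deltaCoin k 0)) j‖ ^ 2
        + (1 / 2) * ‖((U ^ m) (deltaCoin k 1)) j‖ ^ 2 : ℝ) : ℂ) * exp (j * ξ * I) =
      exp (k * ξ * I) *
        (((2 * π)⁻¹ * ∫ θ in (0 : ℝ)..2 * π, symbolKernel m θ (θ + ξ) : ℝ) : ℂ) := by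
  have hF (c d : Fin 2) (θ : ℝ) : ∑ j ∈ s, ((U ^ m) (deltaCoin k c)) j d * exp (j * θ * I) =
      (hadamardSymbol θ ^ m) d c * exp (k * θ * I) := by
    rw [← (hasSum_fourier hU k c θ m d).tsum_eq, tsum_eq_sum]
    intro j hj
    simp [hs c j hj]
  have hP (c d : Fin 2) := integral_conj_mul_translate
    (fun j => ((U ^ m) (deltaCoin k c)) j d) s ξ
  simp_rw [hF] at hP
  have hexp (θ : ℝ) : conj (exp (k * θ * I)) * exp (k * (θ + ξ : ℝ) * I) = exp (k * ξ * I) := by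
    rw [← exp_conj, ← exp_add]
    simp only [map_mul, conj_ofReal, conj_I, map_intCast, mul_neg]
    push_cast
    ring_nf
  have hker (θ : ℝ) : 2 * exp (k * ξ * I) * (symbolKernel m θ (θ + ξ) : ℂ) =
      ∑ c, ∑ d, conj ((hadamardSymbol θ ^ m) d c * exp (k * θ * I)) *
        ((hadamardSymbol (θ + ξ) ^ m) d c * exp (k * (θ + ξ : ℝ) * I)) := by
    rw [mul_right_comm, ← sum_conj_hadamardSymbol_pow_mul, Finset.sum_mul]
    refine Finset.sum_congr rfl fun c _ => ?_
    rw [Finset.sum_mul]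
    refine Finset.sum_congr rfl fun d _ => ?_
    rw [map_mul, ← hexp θ]
    ring
  have hcont (c d : Fin 2) : Continuous fun θ : ℝ => (hadamardSymbol θ ^ m) d c := by
    have : Continuous fun θ : ℝ => hadamardSymbol θ := by
      refine continuous_matrix fun i j => ?_
      fin_cases i <;> fin_cases j <;> simp [hadamardSymbol] <;> fun_prop
    exact (this.pow m).matrix_elem d c
  have hint : 2 * exp (k * ξ * I) * ∫ θ in (0 : ℝ)..2 * π, (symbolKernel m θ (θ + ξ) : ℂ) =
      ∑ c, ∑ d, 2 * π * ∑ j ∈ s, (‖((U ^ m) (deltaCoin k c)) j d‖ : ℂ) ^ 2 * exp (j * ξ * I) := by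
    have hc (c d : Fin 2) : Continuous fun θ : ℝ =>
        conj ((hadamardSymbol θ ^ m) d c * exp (k * θ * I)) *
        ((hadamardSymbol (θ + ξ) ^ m) d c * exp (k * (θ + ξ : ℝ) * I)) :=
      (continuous_conj.comp ((hcont c d).mul (by fun_prop))).mul
        (((hcont c d).comp (continuous_add_const ξ)).mul (by fun_prop))
    rw [← intervalIntegral.integral_const_mul, intervalIntegral.integral_congr fun θ _ => hker θ,
      intervalIntegral.integral_finsetSum fun c _ => (continuous_finsetSum _ fun d _ =>
        hc c d).intervalIntegrable _ _]
    refine Finset.sum_congr rfl fun c _ => ?_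
    rw [intervalIntegral.integral_finsetSum fun d _ => (hc c d).intervalIntegrable _ _]
    exact Finset.sum_congr rfl fun d _ => hP c d
  rw [intervalIntegral.integral_ofReal] at hint
  have hπ : (π : ℂ) ≠ 0 := ofReal_ne_zero.2 Real.pi_ne_zero
  have hnorm (v : EuclideanSpace ℂ (Fin 2)) : ‖v‖ ^ 2 = ‖v 0‖ ^ 2 + ‖v 1‖ ^ 2 := by
    rw [EuclideanSpace.norm_sq_eq, Fin.sum_univ_two]
  simp only [Fin.sum_univ_two, ← mul_add, ← Finset.sum_add_distrib] at hint
  have : ∑ j ∈ s, (((1 / 2) * ‖((U ^ m) (deltaCoin k 0)) j‖ ^ 2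
        + (1 / 2) * ‖((U ^ m) (deltaCoin k 1)) j‖ ^ 2 : ℝ) : ℂ) * exp (j * ξ * I) =
      (4 * π)⁻¹ * (2 * exp (k * ξ * I) *
        ((∫ θ in (0 : ℝ)..2 * π, symbolKernel m θ (θ + ξ) : ℝ) : ℂ)) := by
    rw [hint, ← mul_assoc, Finset.mul_sum]
    refine Finset.sum_congr rfl fun j _ => ?_
    rw [hnorm, hnorm]
    push_cast
    field_simp
    ring
  rw [this]
  push_cast
  field_simp
  ring

lemma symbolKernel_eq (m : ℕ) (θ θ' : ℝ) : symbolKernel m θ θ' =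
    Real.cos (m * (phase θ' - phase θ)) +
      Real.sin (m * phase θ) * Real.sin (m * phase θ') *
        ((Real.cos θ * Real.cos θ' + Real.cos (θ' - θ)) / (phaseNorm θ * phaseNorm θ') - 1) := by
  rw [symbolKernel, mul_sub (m : ℝ), Real.cos_sub (m * phase θ')]
  ring

lemma symbolKernel_factor_self (θ : ℝ) :
    (Real.cos θ * Real.cos θ + Real.cos (θ - θ)) / (phaseNorm θ * phaseNorm θ) = 1 := by
  rw [div_eq_one_iff_eq (mul_pos (phaseNorm_pos θ) (phaseNorm_pos θ)).ne', ← sq, ← sq,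
    phaseNorm_sq, sub_self, Real.cos_zero, add_comm]

lemma symbolKernel_self (m : ℕ) (θ : ℝ) : symbolKernel m θ θ = 1 := by
  simp [symbolKernel_eq, symbolKernel_factor_self, -sub_self, sub_self (phase θ), sub_self (1 : ℝ)]

lemma abs_symbolKernel_le (m : ℕ) (θ θ' : ℝ) : |symbolKernel m θ θ'| ≤ 3 := by
  have h1 : |Real.cos (m * phase θ) * Real.cos (m * phase θ')| ≤ 1 := by
    rw [abs_mul]
    exact mul_le_one₀ (Real.abs_cos_le_one _) (abs_nonneg _) (Real.abs_cos_le_one _)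
  have h2 : |Real.sin (m * phase θ) * Real.sin (m * phase θ')| ≤ 1 := by
    rw [abs_mul]
    exact mul_le_one₀ (Real.abs_sin_le_one _) (abs_nonneg _) (Real.abs_sin_le_one _)
  have h3 : |Real.cos θ * Real.cos θ'| ≤ 1 := by
    rw [abs_mul]
    exact mul_le_one₀ (Real.abs_cos_le_one _) (abs_nonneg _) (Real.abs_cos_le_one _)
  have h4 : |(Real.cos θ * Real.cos θ' + Real.cos (θ' - θ)) / (phaseNorm θ * phaseNorm θ')| ≤ 2 := by
    have hn : 1 ≤ phaseNorm θ * phaseNorm θ' :=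
      one_le_mul_of_one_le_of_one_le (one_le_phaseNorm θ) (one_le_phaseNorm θ')
    rw [abs_div, abs_of_pos (one_pos.trans_le hn)]
    refine (div_le_self (abs_nonneg _) hn).trans ((abs_add_le _ _).trans ?_)
    linarith [Real.abs_cos_le_one (θ' - θ)]
  rw [symbolKernel]
  refine (abs_add_le _ _).trans ?_
  rw [abs_mul (Real.sin (m * phase θ) * Real.sin (m * phase θ'))]
  linarith [mul_le_mul h2 h4 (abs_nonneg _) zero_le_one]

lemma continuous_symbolKernel (m : ℕ) (ξ : ℝ) :
    Continuous fun θ => symbolKernel m θ (θ + ξ) := by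
  unfold symbolKernel
  have h1 := continuous_phase
  have h2 := continuous_phaseNorm
  refine .add (by fun_prop) (.mul (by fun_prop) (.div (by fun_prop) (by fun_prop) fun θ => ?_))
  exact (mul_pos (phaseNorm_pos _) (phaseNorm_pos _)).ne'

lemma tendsto_symbolKernel {m : ℕ → ℕ} {t : ℝ}
    (hm : Tendsto (fun n => (m n : ℝ) / n) atTop (𝓝 t)) (ξ θ : ℝ) :
    Tendsto (fun n : ℕ => symbolKernel (m n) θ (θ + ξ / n)) atTop
      (𝓝 (Real.cos (t * ξ * velocity θ))) := by
  have hξ : Tendsto (fun n : ℕ => θ + ξ / n) atTop (𝓝 θ) := by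
    simpa using (tendsto_const_div_atTop_nhds_zero_nat ξ).const_add θ
  have hinv : Tendsto (fun n : ℕ => (n : ℝ)⁻¹) atTop (𝓝[≠] 0) :=
    (tendsto_inv_atTop_nhdsGT_zero.comp tendsto_natCast_atTop_atTop).mono_right
      (nhdsWithin_mono _ fun _ h => ne_of_gt h)
  have hd : HasDerivAt (fun s : ℝ => phase (θ + s * ξ)) (-velocity θ * ξ) 0 := by
    have h1 : HasDerivAt (fun s : ℝ => θ + s * ξ) ξ 0 := by
      simpa using ((hasDerivAt_id (0 : ℝ)).mul_const ξ).const_add θ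
    have h2 : HasDerivAt phase (-velocity θ) (θ + 0 * ξ) := by simpa using hasDerivAt_phase θ
    exact HasDerivAt.comp (h₂ := phase) (h := fun s : ℝ => θ + s * ξ) 0 h2 h1
  have hslope := (hasDerivAt_iff_tendsto_slope_zero.1 hd).comp hinv
  have hphase : Tendsto (fun n : ℕ => (m n : ℝ) * (phase (θ + ξ / n) - phase θ)) atTop
      (𝓝 (t * (-velocity θ * ξ))) := by
    refine (hm.mul hslope).congr' ?_
    filter_upwards [eventually_ne_atTop 0] with n hn
    have hn' : (n : ℝ) ≠ 0 := Nat.cast_ne_zero.2 hn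
    simp only [Function.comp_apply, zero_add, zero_mul, add_zero, inv_inv, smul_eq_mul]
    rw [inv_mul_eq_div]
    field_simp
  have hfac : Tendsto (fun θ' => (Real.cos θ * Real.cos θ' + Real.cos (θ' - θ)) /
      (phaseNorm θ * phaseNorm θ') - 1) (𝓝 θ) (𝓝 0) := by
    have hc : Continuous fun θ' => (Real.cos θ * Real.cos θ' + Real.cos (θ' - θ)) /
        (phaseNorm θ * phaseNorm θ') - 1 := by
      have h2 := continuous_phaseNorm
      refine .sub (.div (by fun_prop) (by fun_prop) fun θ' => ?_) continuous_const
      exact (mul_pos (phaseNorm_pos _) (phaseNorm_pos _)).ne'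
    have := hc.tendsto θ
    rwa [symbolKernel_factor_self, sub_self] at this
  have herr : Tendsto (fun n : ℕ => Real.sin (m n * phase θ) * Real.sin (m n * phase (θ + ξ / n)) *
        ((Real.cos θ * Real.cos (θ + ξ / n) + Real.cos (θ + ξ / n - θ)) /
          (phaseNorm θ * phaseNorm (θ + ξ / n)) - 1)) atTop (𝓝 0) := by
    refine squeeze_zero_norm (fun n => ?_)
      (tendsto_zero_iff_norm_tendsto_zero.1 (hfac.comp hξ))
    rw [norm_mul, norm_mul]
    exact mul_le_of_le_one_left (norm_nonneg _)
      (mul_le_one₀ (Real.abs_sin_le_one _) (norm_nonneg _) (Real.abs_sin_le_one _))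
  have := ((Real.continuous_cos.tendsto _).comp hphase).add herr
  rw [add_zero, show t * (-velocity θ * ξ) = -(t * ξ * velocity θ) by ring, Real.cos_neg] at this
  exact this.congr fun n => (symbolKernel_eq _ _ _).symm

lemma tendsto_integral_symbolKernel {m : ℕ → ℕ} {t : ℝ}
    (hm : Tendsto (fun n => (m n : ℝ) / n) atTop (𝓝 t)) (ξ : ℝ) :
    Tendsto (fun n : ℕ => ∫ θ in (0 : ℝ)..2 * π, symbolKernel (m n) θ (θ + ξ / n)) atTop
      (𝓝 (∫ θ in (0 : ℝ)..2 * π, Real.cos (t * ξ * velocity θ))) :=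
  intervalIntegral.tendsto_integral_filter_of_dominated_convergence (fun _ => 3)
    (.of_forall fun _ => (continuous_symbolKernel _ _).aestronglyMeasurable)
    (.of_forall fun _ => .of_forall fun _ _ => abs_symbolKernel_le _ _ _)
    intervalIntegrable_const
    (.of_forall fun θ _ => tendsto_symbolKernel hm ξ θ)

lemma velocity_add_pi (θ : ℝ) : velocity (θ + π) = -velocity θ := by
  simp [velocity, phaseNorm, neg_div]

lemma velocity_pi_sub (θ : ℝ) : velocity (π - θ) = -velocity θ := by
  simp [velocity, phaseNorm, neg_div]

lemma integral_exp_velocity (a : ℝ) :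
    ∫ θ in (0 : ℝ)..π, exp (-(a * velocity θ) * I) =
      ((2⁻¹ * ∫ θ in (0 : ℝ)..2 * π, Real.cos (a * velocity θ) : ℝ) : ℂ) := by
  have hv := continuous_velocity
  have hc : Continuous fun θ => Real.cos (a * velocity θ) := by fun_prop
  have hs : ∫ θ in (0 : ℝ)..π, Real.sin (a * velocity θ) = 0 := by
    have h := intervalIntegral.integral_comp_sub_left
      (a := 0) (b := π) (fun θ => Real.sin (a * velocity θ)) π
    simp only [velocity_pi_sub, mul_neg, Real.sin_neg, intervalIntegral.integral_neg, sub_self,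
      sub_zero] at h
    linarith
  have h2 : ∫ θ in (0 : ℝ)..2 * π, Real.cos (a * velocity θ) =
      2 * ∫ θ in (0 : ℝ)..π, Real.cos (a * velocity θ) := by
    have h := intervalIntegral.integral_comp_add_right
      (a := 0) (b := π) (fun θ => Real.cos (a * velocity θ)) π
    simp only [velocity_add_pi, mul_neg, Real.cos_neg, zero_add, ← two_mul] at h
    rw [← intervalIntegral.integral_add_adjacent_intervals (hc.intervalIntegrable 0 π)
      (hc.intervalIntegrable π (2 * π)), ← h, two_mul]
  have he (θ : ℝ) : exp (-(a * velocity θ) * I) =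
      (Real.cos (a * velocity θ) : ℂ) - (Real.sin (a * velocity θ) : ℂ) * I := by
    rw [exp_mul_I, Complex.cos_neg, Complex.sin_neg]; push_cast; ring
  simp_rw [he]
  rw [intervalIntegral.integral_sub (Continuous.intervalIntegrable (by fun_prop) _ _)
    (Continuous.intervalIntegrable (by fun_prop) _ _), intervalIntegral.integral_mul_const,
    intervalIntegral.integral_ofReal, intervalIntegral.integral_ofReal, hs, h2]
  simp

lemma one_sub_velocity_sq (θ : ℝ) : 1 - velocity θ ^ 2 = (phaseNorm θ ^ 2)⁻¹ := by
  have h := phaseNorm_sq θ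
  have := phaseNorm_pos θ
  rw [velocity, div_pow]
  field_simp
  linarith

lemma one_sub_two_mul_velocity_sq (θ : ℝ) :
    1 - 2 * velocity θ ^ 2 = (Real.sin θ / phaseNorm θ) ^ 2 := by
  have h := phaseNorm_sq θ
  have := phaseNorm_pos θ
  rw [velocity, div_pow, div_pow, Real.sin_sq]
  field_simp
  linarith

lemma abs_lt_one_div_sqrt_two_iff (v : ℝ) : |v| < 1 / √2 ↔ 0 < 1 - 2 * v ^ 2 := by
  rw [one_div, ← Real.sqrt_inv, Real.lt_sqrt (abs_nonneg v), sq_abs]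
  constructor <;> intro h <;> linarith

lemma konno_velocity {θ : ℝ} (hθ : θ ∈ Set.Ioo 0 π) :
    konno (velocity θ) = phaseNorm θ ^ 3 / (π * Real.sin θ) := by
  have hs := Real.sin_pos_of_mem_Ioo hθ
  have hn := phaseNorm_pos θ
  rw [konno, if_pos, one_sub_velocity_sq, one_sub_two_mul_velocity_sq,
    Real.sqrt_sq (div_pos hs hn).le]
  · field_simp
  · rw [abs_lt_one_div_sqrt_two_iff, one_sub_two_mul_velocity_sq]
    positivity

lemma hasDerivAt_velocity (θ : ℝ) : HasDerivAt velocity (-(Real.sin θ / phaseNorm θ ^ 3)) θ := by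
  have hn := phaseNorm_pos θ
  have h1 : HasDerivAt phaseNorm
      (((2 : ℕ) * Real.cos θ ^ (2 - 1) * -Real.sin θ) / (2 * √(1 + Real.cos θ ^ 2))) θ :=
    (((Real.hasDerivAt_cos θ).pow 2).const_add 1).sqrt
      (add_pos_of_pos_of_nonneg one_pos (sq_nonneg _)).ne'
  have h2 := (Real.hasDerivAt_cos θ).div h1 hn.ne'
  have e : -(Real.sin θ / phaseNorm θ ^ 3) = (-Real.sin θ * phaseNorm θ - Real.cos θ *
      (((2 : ℕ) * Real.cos θ ^ (2 - 1) * -Real.sin θ) / (2 * √(1 + Real.cos θ ^ 2)))) /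
        phaseNorm θ ^ 2 := by
    rw [← phaseNorm]
    push_cast
    field_simp
    rw [phaseNorm_sq]
    ring
  rw [e]
  exact h2

lemma injOn_velocity : Set.InjOn velocity (Set.Ioo 0 π) := by
  intro a ha b hb hab
  refine Real.injOn_cos (Set.Ioo_subset_Icc_self ha) (Set.Ioo_subset_Icc_self hb) ?_
  have hn : phaseNorm a = phaseNorm b := by
    have h := one_sub_velocity_sq a
    rw [hab, one_sub_velocity_sq, inv_inj] at h
    exact ((sq_eq_sq₀ (phaseNorm_pos b).le (phaseNorm_pos a).le).1 h).symm
  rwa [velocity, velocity, hn, div_left_inj' (phaseNorm_pos b).ne'] at hab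

lemma exists_velocity_eq {v : ℝ} (hv : 0 < 1 - 2 * v ^ 2) : ∃ θ ∈ Set.Ioo 0 π, velocity θ = v := by
  have h1 : 0 < 1 - v ^ 2 := by nlinarith [sq_nonneg v]
  have hs : 0 < √(1 - v ^ 2) := Real.sqrt_pos.2 h1
  have hsq : √(1 - v ^ 2) ^ 2 = 1 - v ^ 2 := Real.sq_sqrt h1.le
  have hc : |v / √(1 - v ^ 2)| < 1 := by
    rw [← sq_lt_one_iff_abs_lt_one, div_pow, hsq, div_lt_one h1]
    linarith
  have hc' := abs_lt.1 hc
  have hcos := Real.cos_arccos hc'.1.le hc'.2.le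
  refine ⟨Real.arccos (v / √(1 - v ^ 2)), ⟨Real.arccos_pos.2 hc'.2, ?_⟩, ?_⟩
  · exact lt_of_le_of_ne (Real.arccos_le_pi _) fun h => hc'.1.not_ge (Real.arccos_eq_pi.1 h)
  · have hn : phaseNorm (Real.arccos (v / √(1 - v ^ 2))) = 1 / √(1 - v ^ 2) := by
      rw [phaseNorm, hcos, div_pow, hsq, ← Real.sqrt_one, ← Real.sqrt_div zero_le_one,
        Real.sqrt_one]
      congr 1
      field_simp
      ring
    rw [velocity, hcos, hn]
    field_simp

/-- The Konno density is the law of `velocity θ` for `θ` uniform on `(0, π)`. -/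
lemma integral_mul_konno_s8 (g : ℝ → ℝ) {t : ℝ} (ht : 0 < t) (x : ℝ) :
    ∫ y : ℝ, g y * ((1 / t) * konno ((x - y) / t)) =
      π⁻¹ * ∫ θ in (0 : ℝ)..π, g (x - t * velocity θ) := by
  have hcov := integral_image_eq_integral_abs_deriv_smul (s := Set.Ioo 0 π)
    (f := fun θ => x - t * velocity θ) (f' := fun θ => t * (Real.sin θ / phaseNorm θ ^ 3))
    measurableSet_Ioo
    (fun θ _ => by
      simpa using (((hasDerivAt_velocity θ).const_mul t).const_sub x).hasDerivWithinAt)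
    (fun a ha b hb hab => injOn_velocity ha hb
      (mul_left_cancel₀ ht.ne' (sub_right_injective hab)))
    (fun y => g y * ((1 / t) * konno ((x - y) / t)))
  rw [setIntegral_eq_integral_of_forall_compl_eq_zero] at hcov
  · rw [hcov, intervalIntegral.integral_of_le Real.pi_pos.le, integral_Ioc_eq_integral_Ioo,
      ← integral_const_mul]
    refine setIntegral_congr_fun measurableSet_Ioo fun θ hθ => ?_
    have hs := Real.sin_pos_of_mem_Ioo hθ
    have hn := phaseNorm_pos θ
    have hx : (x - (x - t * velocity θ)) / t = velocity θ := by field_simp; ring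
    simp only [hx, konno_velocity hθ, smul_eq_mul]
    rw [abs_of_pos (by positivity)]
    field_simp
  · intro y hy
    rw [konno, if_neg, mul_zero, mul_zero]
    rw [abs_lt_one_div_sqrt_two_iff]
    intro h
    obtain ⟨θ, hθ, h⟩ := exists_velocity_eq h
    refine hy ⟨θ, hθ, ?_⟩
    simp only [h]
    field_simp
    ring

lemma integral_sum_dirac {ι E : Type*} [NormedAddCommGroup E] [NormedSpace ℝ E] [CompleteSpace E]
    (s : Finset ι) (w : ι → ℝ) (hw : ∀ j, 0 ≤ w j) (a : ι → ℝ) (g : ℝ → E) :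
    ∫ y, g y ∂(∑ j ∈ s, ENNReal.ofReal (w j) • Measure.dirac (a j)) = ∑ j ∈ s, w j • g (a j) := by
  rw [integral_finsetSum_measure fun j _ =>
    (integrable_dirac (by finiteness)).smul_measure ENNReal.ofReal_ne_top]
  refine Finset.sum_congr rfl fun j _ => ?_
  rw [integral_smul_measure, integral_dirac, ENNReal.toReal_ofReal (hw j)]

lemma isProbabilityMeasure_sum_dirac {ι : Type*} (s : Finset ι) {w : ι → ℝ} (hw : ∀ j, 0 ≤ w j)
    (hsum : ∑ j ∈ s, w j = 1) (a : ι → ℝ) :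
    IsProbabilityMeasure (∑ j ∈ s, ENNReal.ofReal (w j) • Measure.dirac (a j)) := by
  refine ⟨?_⟩
  simp [← ENNReal.ofReal_sum_of_nonneg fun j _ => hw j, hsum]

/-- The law of `x - t * velocity θ` for `θ` uniform on `(0, π]`. -/
def limitLaw (t x : ℝ) : Measure ℝ :=
  (ENNReal.ofReal π⁻¹ • volume.restrict (Set.Ioc 0 π)).map fun θ => x - t * velocity θ

lemma continuous_sub_mul_velocity (t x : ℝ) : Continuous fun θ => x - t * velocity θ := by
  have := continuous_velocity
  fun_prop

instance (t x : ℝ) : IsProbabilityMeasure (limitLaw t x) := by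
  have : IsProbabilityMeasure (ENNReal.ofReal π⁻¹ • volume.restrict (Set.Ioc 0 π)) := by
    refine ⟨?_⟩
    rw [Measure.smul_apply, Measure.restrict_apply_univ, Real.volume_Ioc, sub_zero, smul_eq_mul,
      ← ENNReal.ofReal_mul (by positivity), inv_mul_cancel₀ Real.pi_ne_zero, ENNReal.ofReal_one]
  exact Measure.isProbabilityMeasure_map (continuous_sub_mul_velocity t x).aemeasurable

lemma integral_limitLaw {E : Type*} [NormedAddCommGroup E] [NormedSpace ℝ E]
    [SecondCountableTopology E] [MeasurableSpace E] [BorelSpace E]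
    (t x : ℝ) {g : ℝ → E} (hg : Continuous g) :
    ∫ y, g y ∂limitLaw t x = π⁻¹ • ∫ θ in (0 : ℝ)..π, g (x - t * velocity θ) := by
  rw [limitLaw, integral_map (continuous_sub_mul_velocity t x).aemeasurable
    hg.aestronglyMeasurable, integral_smul_measure, ENNReal.toReal_ofReal (by positivity),
    intervalIntegral.integral_of_le Real.pi_pos.le]

lemma charFun_limitLaw (t x ξ : ℝ) : charFun (limitLaw t x) ξ = exp ((x * ξ : ℝ) * I) *
    (((2 * π)⁻¹ * ∫ θ in (0 : ℝ)..2 * π, Real.cos (t * ξ * velocity θ) : ℝ) : ℂ) := by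
  have he (θ : ℝ) : exp (ξ * (x - t * velocity θ : ℝ) * I) =
      exp ((x * ξ : ℝ) * I) * exp (-((t * ξ : ℝ) * velocity θ) * I) := by
    rw [← exp_add]; push_cast; ring_nf
  rw [charFun_apply_real, integral_limitLaw t x (by fun_prop)]
  simp_rw [he]
  rw [intervalIntegral.integral_const_mul, integral_exp_velocity, real_smul]
  push_cast
  ring

lemma tendsto_int_floor_mul_natCast_div (x : ℝ) :
    Tendsto (fun n : ℕ => (⌊x * n⌋ : ℝ) / n) atTop (𝓝 x) := by
  refine tendsto_of_tendsto_of_tendsto_of_le_of_le'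
    (by simpa using tendsto_const_nhds (x := x) |>.sub (tendsto_const_div_atTop_nhds_zero_nat 1))
    tendsto_const_nhds ?_ ?_ <;> filter_upwards [eventually_gt_atTop 0] with n hn
  · have hn' : (0 : ℝ) < n := Nat.cast_pos.2 hn
    rw [le_div_iff₀ hn', sub_mul, inv_mul_cancel₀ hn'.ne']
    exact (Int.sub_one_lt_floor _).le
  · exact (div_le_iff₀ (Nat.cast_pos.2 hn)).2 (Int.floor_le _)

/-- **Convergence of the local Poisson parameters.**
Let `U` be the Hadamard quantum walk operator on `ℓ²(ℤ; ℂ²)`, defined coordinatewise by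
`(Uψ)₊(k) = (ψ₊(k−1) + ψ₋(k−1))/√2` and `(Uψ)₋(k) = (ψ₊(k+1) − ψ₋(k+1))/√2`, and set
`p_m(k, j) := ½‖(U^m(δ_k ⊗ +))(j)‖² + ½‖(U^m(δ_k ⊗ −))(j)‖²`. Let `γ : ℝ → ℝ` be
continuous and nonnegative with compact support, `t > 0` and `x ∈ ℝ`. Then
`lim_{n→∞} Σ_{k∈ℤ} γ(k/n) p_{⌊tn⌋}(⌊xn⌋, k) = ρ(t,x) = ∫_ℝ γ(y) (1/t) f((x−y)/t) dy`. -/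
theorem convergence_of_local_poisson_parameters
    (U : QWState →ₗ[ℂ] QWState)
    (hU : ∀ (ψ : QWState) (k : ℤ),
      (U ψ) k 0 = (ψ (k - 1) 0 + ψ (k - 1) 1) / (Real.sqrt 2 : ℂ) ∧
      (U ψ) k 1 = (ψ (k + 1) 0 - ψ (k + 1) 1) / (Real.sqrt 2 : ℂ))
    (p : ℕ → ℤ → ℤ → ℝ)
    (hp : ∀ (n : ℕ) (k j : ℤ), p n k j =
      (1 / 2) * ‖((U ^ n) (deltaCoin k 0)) j‖ ^ 2
        + (1 / 2) * ‖((U ^ n) (deltaCoin k 1)) j‖ ^ 2)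
    (γ : ℝ → ℝ) (hγcont : Continuous γ) (hγnonneg : ∀ y, 0 ≤ γ y)
    (hγsupp : HasCompactSupport γ)
    (t : ℝ) (ht : 0 < t) (x : ℝ) :
    Tendsto
      (fun n : ℕ => ∑' k : ℤ, γ ((k : ℝ) / (n : ℝ)) * p ⌊t * (n : ℝ)⌋₊ ⌊x * (n : ℝ)⌋ k)
      atTop
      (𝓝 (∫ y : ℝ, γ y * ((1 / t) * konno ((x - y) / t)))) := by
  let m : ℕ → ℕ := fun n => ⌊t * (n : ℝ)⌋₊
  let k : ℕ → ℤ := fun n => ⌊x * (n : ℝ)⌋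
  have hsupp (n : ℕ) : ∃ s : Finset ℤ, ∀ c, ∀ j ∉ s, ((U ^ m n) (deltaCoin (k n) c)) j = 0 := by
    obtain ⟨s₀, h₀⟩ := exists_finset_support hU (k n) 0 (m n)
    obtain ⟨s₁, h₁⟩ := exists_finset_support hU (k n) 1 (m n)
    refine ⟨s₀ ∪ s₁, Fin.forall_fin_two.2 ⟨fun j hj => h₀ j ?_, fun j hj => h₁ j ?_⟩⟩ <;>
      simp_all
  choose s hs using hsupp
  have hchar (n : ℕ) (ξ : ℝ) := sum_transition_mul_exp hU (m n) (k n) (s n) (hs n) ξ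
  simp_rw [← hp] at hchar
  have hp0 (n : ℕ) (j : ℤ) (hj : j ∉ s n) : p (m n) (k n) j = 0 := by simp [hp, hs n _ j hj]
  have hpos (n : ℕ) (j : ℤ) : 0 ≤ p (m n) (k n) j := by rw [hp]; positivity
  have hsum (n : ℕ) : ∑ j ∈ s n, p (m n) (k n) j = 1 := by
    have h := hchar n 0
    simp only [add_zero, symbolKernel_self, intervalIntegral.integral_const, sub_zero, smul_eq_mul,
      mul_one, ofReal_zero, mul_zero, zero_mul, exp_zero, one_mul] at h
    rw [inv_mul_cancel₀ Real.two_pi_pos.ne'] at h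
    exact_mod_cast h
  let μ (n : ℕ) : ProbabilityMeasure ℝ :=
    ⟨∑ j ∈ s n, ENNReal.ofReal (p (m n) (k n) j) • Measure.dirac ((j : ℝ) / n),
      isProbabilityMeasure_sum_dirac _ (fun j => hpos n j) (hsum n) _⟩
  let ν : ProbabilityMeasure ℝ := ⟨limitLaw t x, inferInstance⟩
  have hlim : Tendsto μ atTop (𝓝 ν) := by
    refine ProbabilityMeasure.tendsto_iff_tendsto_charFun.2 fun ξ => ?_
    have hμ (n : ℕ) : charFun (μ n) ξ = exp (((k n : ℝ) / n * ξ : ℝ) * I) *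
        (((2 * π)⁻¹ * ∫ θ in (0 : ℝ)..2 * π, symbolKernel (m n) θ (θ + ξ / n) : ℝ) : ℂ) := by
      rw [charFun_apply_real]
      refine (integral_sum_dirac _ _ (hpos n) _ _).trans ?_
      convert! hchar n (ξ / n) using 1
      · refine Finset.sum_congr rfl fun j _ => ?_
        rw [real_smul]
        push_cast
        ring_nf
      · congr 2
        push_cast
        ring
    have hν : charFun (ν : Measure ℝ) ξ = exp ((x * ξ : ℝ) * I) *
        (((2 * π)⁻¹ * ∫ θ in (0 : ℝ)..2 * π, Real.cos (t * ξ * velocity θ) : ℝ) : ℂ) :=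
      charFun_limitLaw t x ξ
    simp_rw [hμ, hν]
    have hkn : Tendsto (fun n : ℕ => (k n : ℝ) / n * ξ) atTop (𝓝 (x * ξ)) :=
      (tendsto_int_floor_mul_natCast_div x).mul_const ξ
    have hmn : Tendsto (fun n : ℕ => (m n : ℝ) / n) atTop (𝓝 t) :=
      (tendsto_nat_floor_mul_div_atTop ht.le).comp tendsto_natCast_atTop_atTop
    refine Tendsto.mul ?_ ?_
    · have hc : Continuous fun r : ℝ => exp (r * I) := by fun_prop
      exact (hc.tendsto _).comp hkn
    · exact (continuous_ofReal.tendsto _).comp ((tendsto_integral_symbolKernel hmn ξ).const_mul _)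
  obtain ⟨C, hC⟩ := hγsupp.exists_bound_of_continuous hγcont
  have h := ProbabilityMeasure.tendsto_iff_forall_integral_tendsto.1 hlim
    (BoundedContinuousFunction.ofNormedAddCommGroup γ hγcont C hC)
  simp only [BoundedContinuousFunction.coe_ofNormedAddCommGroup] at h
  rw [integral_mul_konno_s8 γ ht x, ← smul_eq_mul, ← integral_limitLaw t x hγcont]
  refine h.congr fun n => ?_
  rw [tsum_eq_sum (s := s n) fun j hj => by rw [hp0 n j hj, mul_zero]]
  refine (integral_sum_dirac _ _ (hpos n) _ _).trans (Finset.sum_congr rfl fun j _ => ?_)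
  rw [smul_eq_mul, mul_comm]

end
end
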